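/- arXiv:1207.0411 — 2 statements merged into one kernel-verified Lean document; each statement's English description precedes it below -/
import Mathlib

section
/- Let A and H be Hopf algebras over a field k, let ▷ : H ⊗ A → A be a weak action and f : H ⊗ H → A a k-linear map. Then A #_f^▷ H is a crossed product of Hopf algebras if and only if ▷ and f are morphisms of coalgebras satisfying, for all a ∈ A and g, h, l ∈ H: (i) f(h,1_H) = f(1_H,h) = ε_H(h)1_A; (ii) [g₍₁₎ ▷ (h₍₁₎ ▷ a)] f(g₍₂₎, h₍₂₎) = f(g₍₁₎, h₍₁₎) ((g₍₂₎h₍₂₎) ▷ a); (iii) (g₍₁₎ ▷ f(h₍₁₎, l₍₁₎)) f(g₍₂₎, h₍₂₎l₍₂₎) = f(g₍₁₎, h₍₁₎) f(g₍₂₎h₍₂₎, l); (iv) g₍₁₎ ⊗ (g₍₂₎ ▷ a) = g₍₂₎ ⊗ (g₍₁₎ ▷ a); (v) g₍₁₎h₍₁₎ ⊗ f(g₍₂₎, h₍₂₎) = g₍₂₎h₍₂₎ ⊗ f(g₍₁₎, h₍₁₎). In this case the antipode of A #_f^▷ H is given by S(a # g) = (S_A[f(S_H(g₍₂₎), g₍₃₎)]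 # S_H(g₍₁₎)) · (S_A(a) # 1_H). -/
open TensorProduct BigOperators

universe u

section Core

variable (k : Type u) [CommRing k]

/-- A linear map between coalgebras is a morphism of coalgebras. -/
def IsCoalgebraMap {V W : Type u} [AddCommGroup V] [Module k V] [Coalgebra k V]
    [AddCommGroup W] [Module k W] [Coalgebra k W] (φ : V →ₗ[k] W) : Prop :=
  (Coalgebra.comul ∘ₗ φ = (TensorProduct.map φ φ) ∘ₗ Coalgebra.comul) ∧
  (Coalgebra.counit (R := k) ∘ₗ φ = Coalgebra.counit)

variable (V : Type u) [AddCommGroup V] [Module k V] [Coalgebra k V]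

/-- The threefold comultiplication `(id ⊗ Δ) ∘ Δ`. -/
noncomputable def comul3 : V →ₗ[k] V ⊗[k] (V ⊗[k] V) :=
  (TensorProduct.map LinearMap.id Coalgebra.comul) ∘ₗ Coalgebra.comul

/-- The fourfold comultiplication. -/
noncomputable def comul4 : V →ₗ[k] V ⊗[k] (V ⊗[k] (V ⊗[k] V)) :=
  (TensorProduct.map LinearMap.id (comul3 k V)) ∘ₗ Coalgebra.comul

/-- The fivefold comultiplication. -/
noncomputable def comul5 : V →ₗ[k] V ⊗[k] (V ⊗[k] (V ⊗[k] (V ⊗[k] V))) :=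
  (TensorProduct.map LinearMap.id (comul4 k V)) ∘ₗ Coalgebra.comul

/-- A Hopf algebra structure on a module `V` compatible with a given coalgebra structure:
the data of a multiplication, unit and antipode making `V` into a Hopf algebra whose
underlying coalgebra is the given one. Sweedler-type conditions are expressed by
quantifying over finite representations of the comultiplication. -/
structure HopfAlgebraOn where
  mul : V →ₗ[k] V →ₗ[k] V
  one : V
  mul_assoc : ∀ x y z : V, mul (mul x y) z = mul x (mul y z)
  one_mul : ∀ x : V, mul one x = x
  mul_one : ∀ x : V, mul x one = x
  counit_one : Coalgebra.counit (R := k) one = 1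
  counit_mul : ∀ x y : V,
    Coalgebra.counit (R := k) (mul x y) =
      Coalgebra.counit (R := k) x * Coalgebra.counit (R := k) y
  comul_one : Coalgebra.comul (R := k) one = one ⊗ₜ[k] one
  comul_mul : ∀ (x y : V) (n m : ℕ) (x₁ x₂ : Fin n → V) (y₁ y₂ : Fin m → V),
    Coalgebra.comul (R := k) x = ∑ i, x₁ i ⊗ₜ[k] x₂ i →
    Coalgebra.comul (R := k) y = ∑ j, y₁ j ⊗ₜ[k] y₂ j →
    Coalgebra.comul (R := k) (mul x y) =
      ∑ i, ∑ j, mul (x₁ i) (y₁ j) ⊗ₜ[k] mul (x₂ i) (y₂ j)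
  antipode : V →ₗ[k] V
  antipode_mul_id : ∀ (x : V) (n : ℕ) (x₁ x₂ : Fin n → V),
    Coalgebra.comul (R := k) x = ∑ i, x₁ i ⊗ₜ[k] x₂ i →
    ∑ i, mul (antipode (x₁ i)) (x₂ i) = Coalgebra.counit (R := k) x • one
  id_mul_antipode : ∀ (x : V) (n : ℕ) (x₁ x₂ : Fin n → V),
    Coalgebra.comul (R := k) x = ∑ i, x₁ i ⊗ₜ[k] x₂ i →
    ∑ i, mul (x₁ i) (antipode (x₂ i)) = Coalgebra.counit (R := k) x • one

end Core

section Crossed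

variable (k : Type u) [CommRing k]
variable (A : Type u) [Ring A] [HopfAlgebra k A]
variable (H : Type u) [Ring H] [HopfAlgebra k H]

/-- `▷ : H ⊗ A → A` is a weak action of `H` on `A`. -/
def IsWeakAction (act : H ⊗[k] A →ₗ[k] A) : Prop :=
  (∀ h : H, act (h ⊗ₜ[k] (1 : A)) = Coalgebra.counit (R := k) h • (1 : A)) ∧
  (∀ a : A, act ((1 : H) ⊗ₜ[k] a) = a) ∧
  (∀ (h : H) (a b : A) (n : ℕ) (h₁ h₂ : Fin n → H),
    Coalgebra.comul (R := k) h = ∑ i, h₁ i ⊗ₜ[k] h₂ i →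
    act (h ⊗ₜ[k] (a * b)) = ∑ i, act (h₁ i ⊗ₜ[k] a) * act (h₂ i ⊗ₜ[k] b))

/-- The multiplication of `hs` is the crossed product multiplication
`(a # h)(c # g) = a (h₁ ▷ c) f(h₂, g₁) # h₃ g₂`. -/
def CrossedProductMul (hs : HopfAlgebraOn k (A ⊗[k] H))
    (act : H ⊗[k] A →ₗ[k] A) (f : H ⊗[k] H →ₗ[k] A) : Prop :=
  ∀ (a c : A) (h g : H) (n m : ℕ) (h₁ h₂ h₃ : Fin n → H) (g₁ g₂ : Fin m → H),
    comul3 k H h = ∑ i, h₁ i ⊗ₜ[k] (h₂ i ⊗ₜ[k] h₃ i) →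
    Coalgebra.comul (R := k) g = ∑ j, g₁ j ⊗ₜ[k] g₂ j →
    hs.mul (a ⊗ₜ[k] h) (c ⊗ₜ[k] g) =
      ∑ i, ∑ j, (a * act (h₁ i ⊗ₜ[k] c) * f (h₂ i ⊗ₜ[k] g₁ j)) ⊗ₜ[k] (h₃ i * g₂ j)

/-- `(A, H, ▷, f)` is a crossed system of Hopf algebras, i.e. `A #_f^▷ H` is a crossed
product of Hopf algebras: the crossed product multiplication, the unit `1 ⊗ 1` and the
tensor product coalgebra structure make `A ⊗ H` into a Hopf algebra. -/
def IsCrossedSystem (act : H ⊗[k] A →ₗ[k] A) (f : H ⊗[k] H →ₗ[k] A) : Prop :=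
  ∃ hs : HopfAlgebraOn k (A ⊗[k] H),
    hs.one = (1 : A) ⊗ₜ[k] (1 : H) ∧ CrossedProductMul k A H hs act f

end Crossed

section Convolution

open Coalgebra LinearMap WithConv

/-- Linear maps from a coalgebra to an algebra, with the convolution product. -/
abbrev Conv (k C B : Type u) [CommRing k] [AddCommGroup C] [Module k C] [Ring B] [Algebra k B] :
    Type u :=
  WithConv (C →ₗ[k] B)

variable {k : Type u} [CommRing k]
variable {C D : Type u} [AddCommGroup C] [Module k C] [Coalgebra k C]
  [AddCommGroup D] [Module k D] [Coalgebra k D]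
variable {B B' : Type u} [Ring B] [Algebra k B] [Ring B'] [Algebra k B']

namespace Conv

lemma ext_apply {C : Type u} [AddCommGroup C] [Module k C] {X Y : Conv k C B}
    (h : ∀ c, X c = Y c) : X = Y :=
  WithConv.ext (LinearMap.ext h)

/-- Postcomposition with an algebra map, as a ring map of convolution algebras. -/
noncomputable def post (φ : B →ₐ[k] B') : Conv k C B →+* Conv k C B' where
  toFun X := toConv (φ.toLinearMap ∘ₗ X.ofConv)
  map_one' := by ext c; simp
  map_mul' X Y := WithConv.ext (algHom_comp_convMul_distrib φ X Y)
  map_zero' := by ext c; simp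
  map_add' X Y := by ext c; simp

@[simp] lemma post_apply (φ : B →ₐ[k] B') (X : Conv k C B) (c : C) : post φ X c = φ (X c) := rfl

/-- Precomposition with a coalgebra map, as a ring map of convolution algebras. -/
noncomputable def pre (π : D →ₗc[k] C) : Conv k C B →+* Conv k D B where
  toFun X := toConv (X.ofConv ∘ₗ π.toLinearMap)
  map_one' := by ext c; simp
  map_mul' X Y := WithConv.ext (convMul_comp_coalgHom_distrib X Y π)
  map_zero' := by ext c; simp
  map_add' X Y := by ext c; simp

@[simp] lemma pre_apply (π : D →ₗc[k] C) (X : Conv k C B) (d : D) : pre π X d = X (π d) := rfl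

lemma pre_post (π : D →ₗc[k] C) (φ : B →ₐ[k] B') (X : Conv k C B) :
    pre π (post φ X) = post φ (pre π X) := rfl

lemma mul_apply_of_repr {ι : Type*} [Fintype ι] (X Y : Conv k C B) {c : C} {c₁ c₂ : ι → C}
    (h : comul (R := k) c = ∑ i, c₁ i ⊗ₜ[k] c₂ i) : (X * Y) c = ∑ i, X (c₁ i) * Y (c₂ i) := by
  rw [convMul_apply, h]; simp

lemma mul_mul_apply_of_repr {ι : Type*} [Fintype ι] (X Y Z : Conv k C B) {c : C}
    {c₁ c₂ c₃ : ι → C} (h : comul3 k C c = ∑ i, c₁ i ⊗ₜ[k] (c₂ i ⊗ₜ[k] c₃ i)) :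
    (X * (Y * Z)) c = ∑ i, X (c₁ i) * (Y (c₂ i) * Z (c₃ i)) := by
  have key : (X * (Y * Z)) c =
      mul' k B (map X.ofConv (mul' k B ∘ₗ map Y.ofConv Z.ofConv) (comul3 k C c)) := by
    rw [(ℛ k c).convMul_apply, comul3, LinearMap.comp_apply, ← (ℛ k c).eq]
    simp
  rw [key, h]; simp

lemma smul_apply (r : k) (X : Conv k C B) (c : C) : (r • X) c = r • X c := rfl

lemma add_apply (X Y : Conv k C B) (c : C) : (X + Y) c = X c + Y c := rfl

lemma one_apply (c : C) : (1 : Conv k C B) c = counit (R := k) c • (1 : B) := by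
  rw [convOne_apply, Algebra.algebraMap_eq_smul_one]

end Conv

variable (k C D) in
/-- The projection `C ⊗ D → C` given by the counit of `D`. -/
noncomputable def fstC : C ⊗[k] D →ₗc[k] C :=
  (Coalgebra.TensorProduct.rid k k C).toCoalgHom.comp
    (Coalgebra.TensorProduct.map (CoalgHom.id k C) (counitCoalgHom k D))

variable (k C D) in
/-- The projection `C ⊗ D → D` given by the counit of `C`. -/
noncomputable def sndC : C ⊗[k] D →ₗc[k] D :=
  (Coalgebra.TensorProduct.lid k D).toCoalgHom.comp
    (Coalgebra.TensorProduct.map (counitCoalgHom k C) (CoalgHom.id k D))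

@[simp] lemma fstC_tmul (c : C) (d : D) : fstC k C D (c ⊗ₜ d) = counit (R := k) d • c := rfl

@[simp] lemma sndC_tmul (c : C) (d : D) : sndC k C D (c ⊗ₜ d) = counit (R := k) c • d := rfl

lemma sum_counit_smul_right {ι : Type*} {c : C} (R : Repr k c ι) :
    ∑ i ∈ R.index, counit (R := k) (R.right i) • R.left i = c := by
  have := congrArg (TensorProduct.rid k C) (sum_tmul_counit_eq R)
  simpa only [map_sum, TensorProduct.rid_tmul, one_smul] using this

namespace Conv

lemma mul_tmul {ι κ : Type*} (X Y : Conv k (C ⊗[k] D) B) {c : C} {d : D} (R : Repr k c ι)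
    (S : Repr k d κ) :
    (X * Y) (c ⊗ₜ d) = ∑ i ∈ R.index, ∑ j ∈ S.index,
      X (R.left i ⊗ₜ S.left j) * Y (R.right i ⊗ₜ S.right j) := by
  rw [convMul_apply, TensorProduct.comul_tmul, ← R.eq, ← S.eq]
  simp [TensorProduct.sum_tmul, TensorProduct.tmul_sum]
  exact Finset.sum_comm

lemma mul_tmul_of_repr {ι κ : Type*} [Fintype ι] [Fintype κ] (X Y : Conv k (C ⊗[k] D) B)
    {c : C} {d : D} {c₁ c₂ : ι → C} {d₁ d₂ : κ → D}
    (h : comul (R := k) c = ∑ i, c₁ i ⊗ₜ[k] c₂ i) (h' : comul (R := k) d = ∑ i, d₁ i ⊗ₜ[k] d₂ i) :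
    (X * Y) (c ⊗ₜ d) = ∑ i, ∑ j, X (c₁ i ⊗ₜ d₁ j) * Y (c₂ i ⊗ₜ d₂ j) :=
  mul_tmul X Y ⟨Finset.univ, c₁, c₂, h.symm⟩ ⟨Finset.univ, d₁, d₂, h'.symm⟩

lemma pre_fstC_mul_tmul {ι : Type*} (X : Conv k C B) (Y : Conv k (C ⊗[k] D) B) {c : C} (d : D)
    (R : Repr k c ι) :
    (pre (fstC k C D) X * Y) (c ⊗ₜ d) = ∑ i ∈ R.index, X (R.left i) * Y (R.right i ⊗ₜ d) := by
  rw [mul_tmul _ _ R (ℛ k d)]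
  refine Finset.sum_congr rfl fun i _ => ?_
  conv_rhs => rw [← sum_counit_smul (ℛ k d)]
  simp [TensorProduct.tmul_sum, Finset.mul_sum]

lemma mul_pre_fstC_tmul {ι : Type*} (X : Conv k C B) (Y : Conv k (C ⊗[k] D) B) {c : C} (d : D)
    (R : Repr k c ι) :
    (Y * pre (fstC k C D) X) (c ⊗ₜ d) = ∑ i ∈ R.index, Y (R.left i ⊗ₜ d) * X (R.right i) := by
  rw [mul_tmul _ _ R (ℛ k d)]
  refine Finset.sum_congr rfl fun i _ => ?_
  conv_rhs => rw [← sum_counit_smul_right (ℛ k d)]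
  simp [TensorProduct.tmul_sum, Finset.sum_mul]

end Conv

end Convolution

section CrossedProduct

open Coalgebra LinearMap WithConv Conv

variable {k : Type u} [CommRing k]
variable {C D E : Type u} [AddCommGroup C] [Module k C] [Coalgebra k C]
  [AddCommGroup D] [Module k D] [Coalgebra k D]
  [AddCommGroup E] [Module k E] [Coalgebra k E]
variable {A : Type u} [Ring A] [HopfAlgebra k A]
variable {H : Type u} [Ring H] [HopfAlgebra k H]

namespace Conv

lemma post_post {B B' B'' : Type u} [Ring B] [Algebra k B] [Ring B'] [Algebra k B']
    [Ring B''] [Algebra k B''] (φ : B →ₐ[k] B') (ψ : B' →ₐ[k] B'') (X : Conv k C B) :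
    post ψ (post φ X) = post (ψ.comp φ) X := rfl

variable (k H) in
/-- The identity of `H`, as an element of the convolution algebra. -/
def idC : Conv k H H := toConv LinearMap.id

@[simp] lemma idC_apply (h : H) : idC k H h = h := rfl

end Conv

variable (k A H) in
/-- The algebra inclusion `A → A ⊗ H`. -/
noncomputable abbrev inA : A →ₐ[k] A ⊗[k] H := Algebra.TensorProduct.includeLeft

variable (k A H) in
/-- The algebra inclusion `H → A ⊗ H`. -/
noncomputable abbrev inH : H →ₐ[k] A ⊗[k] H := Algebra.TensorProduct.includeRight

variable (k) in
/-- The coalgebra map `c ↦ c ⊗ 1`. -/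
noncomputable def inlC (C H : Type u) [AddCommGroup C] [Module k C] [Coalgebra k C]
    [Ring H] [HopfAlgebra k H] : C →ₗc[k] C ⊗[k] H where
  toLinearMap := (TensorProduct.mk k C H).flip 1
  counit_comp := by ext; simp
  map_comp_comul := by
    ext c
    simp [← (ℛ k c).eq, TensorProduct.sum_tmul, Algebra.TensorProduct.one_def]

variable (k) in
/-- The coalgebra map `c ↦ 1 ⊗ c`. -/
noncomputable def inrC (C H : Type u) [AddCommGroup C] [Module k C] [Coalgebra k C]
    [Ring H] [HopfAlgebra k H] : C →ₗc[k] H ⊗[k] C where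
  toLinearMap := TensorProduct.mk k H C 1
  counit_comp := by ext; simp
  map_comp_comul := by
    ext c
    simp [← (ℛ k c).eq, TensorProduct.tmul_sum, Algebra.TensorProduct.one_def]

@[simp] lemma inlC_apply (c : C) : inlC k C H c = c ⊗ₜ 1 := rfl

@[simp] lemma inrC_apply (c : C) : inrC k C H c = 1 ⊗ₜ c := rfl

variable (act : H ⊗[k] A →ₗ[k] A) (f : H ⊗[k] H →ₗ[k] A)

/-- The map `h ↦ h ▷ a`. -/
noncomputable def actAt (a : A) : Conv k H A := toConv (act ∘ₗ (TensorProduct.mk k H A).flip a)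

@[simp] lemma actAt_apply (a : A) (h : H) : actAt act a h = act (h ⊗ₜ a) := rfl

/-- The map `h ⊗ c ↦ h ▷ X(c)`. -/
noncomputable def actOn {C : Type u} [AddCommGroup C] [Module k C] (X : Conv k C A) :
    Conv k (H ⊗[k] C) A :=
  toConv (act ∘ₗ TensorProduct.map LinearMap.id X.ofConv)

@[simp] lemma actOn_apply {C : Type u} [AddCommGroup C] [Module k C] (X : Conv k C A) (h : H)
    (c : C) :
    actOn act X (h ⊗ₜ c) = act (h ⊗ₜ X c) := rfl

/-- The map `h ⊗ g ↦ f(h₁, g₁) # h₂g₂`. -/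
noncomputable def cocycleMul : Conv k (H ⊗[k] H) (A ⊗[k] H) :=
  post (inA k A H) (toConv f) * post (inH k A H) (pre (Bialgebra.mulCoalgHom k H) (idC k H))

/-- The map `h ⊗ g ↦ (h₁ ▷ c) f(h₂, g₁) # h₃g₂`. -/
noncomputable def smashMul (c : A) : Conv k (H ⊗[k] H) (A ⊗[k] H) :=
  pre (fstC k H H) (post (inA k A H) (actAt act c)) * cocycleMul f

lemma smashMul_tmul_of_repr (a c : A) (h g : H) (n m : ℕ) (h₁ h₂ h₃ : Fin n → H)
    (g₁ g₂ : Fin m → H) (hh : comul3 k H h = ∑ i, h₁ i ⊗ₜ[k] (h₂ i ⊗ₜ[k] h₃ i))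
    (hg : comul (R := k) g = ∑ j, g₁ j ⊗ₜ[k] g₂ j) :
    inA k A H a * smashMul act f c (h ⊗ₜ g) =
      ∑ i, ∑ j, (a * act (h₁ i ⊗ₜ[k] c) * f (h₂ i ⊗ₜ[k] g₁ j)) ⊗ₜ[k] (h₃ i * g₂ j) := by
  let P (j : Fin m) : Conv k H (A ⊗[k] H) :=
    post (inA k A H) (toConv (f ∘ₗ (TensorProduct.mk k H H).flip (g₁ j)))
  let Q (j : Fin m) : Conv k H (A ⊗[k] H) :=
    post (inH k A H) (toConv (LinearMap.mulRight k (g₂ j)))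
  have key : smashMul act f c (h ⊗ₜ g) =
      ∑ j, (post (inA k A H) (actAt act c) * (P j * Q j)) h := by
    rw [smashMul, pre_post, ← pre_post, pre_fstC_mul_tmul _ _ _ (ℛ k h)]
    simp_rw [(ℛ k h).convMul_apply]
    rw [Finset.sum_comm]
    refine Finset.sum_congr rfl fun i _ => ?_
    rw [← Finset.mul_sum, cocycleMul, mul_tmul _ _ (ℛ k _) ⟨Finset.univ, g₁, g₂, hg.symm⟩,
      Finset.sum_comm]
    congr 1
    refine Finset.sum_congr rfl fun j _ => ?_
    rw [(ℛ k _).convMul_apply]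
    rfl
  rw [key, Finset.mul_sum]
  simp_rw [mul_mul_apply_of_repr _ _ _ hh, Finset.mul_sum]
  rw [Finset.sum_comm]
  refine Finset.sum_congr rfl fun i _ => Finset.sum_congr rfl fun j _ => ?_
  simp [P, Q, mul_assoc]

/-- `mul` is the crossed product multiplication on `A ⊗ H`. -/
def IsCrossedMul (mul : A ⊗[k] H →ₗ[k] A ⊗[k] H →ₗ[k] A ⊗[k] H) : Prop :=
  ∀ (a c : A) (h g : H),
    mul (a ⊗ₜ h) (c ⊗ₜ g) = inA k A H a * smashMul act f c (h ⊗ₜ g)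

lemma TensorProduct.exists_fin_sum {M N : Type u} [AddCommGroup M] [Module k M] [AddCommGroup N]
    [Module k N] (t : M ⊗[k] N) :
    ∃ (n : ℕ) (x : Fin n → M) (y : Fin n → N), t = ∑ i, x i ⊗ₜ[k] y i := by
  obtain ⟨S, hS⟩ := TensorProduct.exists_finset t
  refine ⟨S.card, fun i => (S.equivFin.symm i).1.1, fun i => (S.equivFin.symm i).1.2, ?_⟩
  rw [hS, ← Finset.sum_coe_sort]
  exact (Equiv.sum_comp S.equivFin.symm fun i : S => i.1.1 ⊗ₜ[k] i.1.2).symm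

lemma TensorProduct.exists_fin_sum₃ {M N P : Type u} [AddCommGroup M] [Module k M]
    [AddCommGroup N] [Module k N] [AddCommGroup P] [Module k P] (t : M ⊗[k] (N ⊗[k] P)) :
    ∃ (n : ℕ) (x : Fin n → M) (y : Fin n → N) (z : Fin n → P),
      t = ∑ i, x i ⊗ₜ[k] (y i ⊗ₜ[k] z i) := by
  obtain ⟨n, x, u, rfl⟩ := TensorProduct.exists_fin_sum t
  choose m y z h using fun i => TensorProduct.exists_fin_sum (u i)
  let e := Fintype.equivFin (Σ i, Fin (m i))
  refine ⟨_, fun i => x (e.symm i).1, fun i => y _ (e.symm i).2, fun i => z _ (e.symm i).2, ?_⟩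
  rw [Equiv.sum_comp e.symm fun p : Σ i, Fin (m i) => x p.1 ⊗ₜ[k] (y p.1 p.2 ⊗ₜ[k] z p.1 p.2),
    Fintype.sum_sigma]
  refine Finset.sum_congr rfl fun i _ => ?_
  rw [h i, TensorProduct.tmul_sum]

lemma crossedProductMul_iff (hs : HopfAlgebraOn k (A ⊗[k] H)) :
    CrossedProductMul k A H hs act f ↔ IsCrossedMul act f hs.mul := by
  constructor
  · intro hm a c h g
    obtain ⟨n, h₁, h₂, h₃, hh⟩ := TensorProduct.exists_fin_sum₃ (comul3 k H h)
    obtain ⟨m, g₁, g₂, hg⟩ := TensorProduct.exists_fin_sum (comul (R := k) g)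
    rw [hm a c h g n m h₁ h₂ h₃ g₁ g₂ hh hg,
      smashMul_tmul_of_repr act f a c h g n m h₁ h₂ h₃ g₁ g₂ hh hg]
  · intro hm a c h g n m h₁ h₂ h₃ g₁ g₂ hh hg
    rw [hm, smashMul_tmul_of_repr act f a c h g n m h₁ h₂ h₃ g₁ g₂ hh hg]

namespace IsWeakAction

variable {act}

lemma actAt_one (hact : IsWeakAction k A H act) : actAt act 1 = 1 :=
  ext_apply fun h => by rw [one_apply]; exact hact.1 h

lemma actOn_one (hact : IsWeakAction k A H act) : actOn act (1 : Conv k C A) = 1 := by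
  refine ext_apply fun t => ?_
  induction t with
  | zero => simp
  | add x y hx hy => rw [map_add, map_add, hx, hy]
  | tmul h c =>
    rw [actOn_apply, one_apply, one_apply, TensorProduct.tmul_smul, map_smul, hact.1,
      TensorProduct.counit_tmul, smul_smul, smul_eq_mul]

lemma actOn_mul (hact : IsWeakAction k A H act) (X Y : Conv k C A) :
    actOn act (X * Y) = actOn act X * actOn act Y := by
  refine ext_apply fun t => ?_
  induction t with
  | zero => simp
  | add x y hx hy => rw [map_add, map_add, hx, hy]
  | tmul h c =>
    obtain ⟨n, h₁, h₂, hh⟩ := TensorProduct.exists_fin_sum (comul (R := k) h)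
    obtain ⟨m, c₁, c₂, hc⟩ := TensorProduct.exists_fin_sum (comul (R := k) c)
    rw [actOn_apply, mul_apply_of_repr _ _ hc, mul_tmul_of_repr _ _ hh hc, TensorProduct.tmul_sum,
      map_sum, Finset.sum_comm]
    exact Finset.sum_congr rfl fun i _ => hact.2.2 h _ _ n h₁ h₂ hh

end IsWeakAction

end CrossedProduct

section Conditions

open Coalgebra LinearMap WithConv Conv

variable {k : Type u} [CommRing k]
variable {C D E : Type u} [AddCommGroup C] [Module k C] [Coalgebra k C]
  [AddCommGroup D] [Module k D] [Coalgebra k D]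
  [AddCommGroup E] [Module k E] [Coalgebra k E]
variable {A : Type u} [Ring A] [HopfAlgebra k A]
variable {H : Type u} [Ring H] [HopfAlgebra k H]

namespace Conv

/-- A representation of the comultiplication of a pure tensor. -/
def reprTmul {ι κ : Type*} {c : C} {d : D} (R : Repr k c ι) (S : Repr k d κ) :
    Repr k (c ⊗ₜ[k] d) (ι × κ) where
  index := R.index ×ˢ S.index
  left p := R.left p.1 ⊗ₜ S.left p.2
  right p := R.right p.1 ⊗ₜ S.right p.2
  eq := by
    rw [TensorProduct.comul_tmul, ← R.eq, ← S.eq, Finset.sum_product]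
    simp [TensorProduct.sum_tmul, TensorProduct.tmul_sum]
    exact Finset.sum_comm

lemma pre_fstC_mul_tmul_tmul_of_repr {B : Type u} [Ring B] [Algebra k B] {ι κ : Type*} [Fintype ι]
    [Fintype κ] (X : Conv k (C ⊗[k] D) B)
    (Y : Conv k ((C ⊗[k] D) ⊗[k] E) B) {c : C} {d : D} (e : E)
    {c₁ c₂ : ι → C} {d₁ d₂ : κ → D}
    (h : comul (R := k) c = ∑ i, c₁ i ⊗ₜ[k] c₂ i) (h' : comul (R := k) d = ∑ i, d₁ i ⊗ₜ[k] d₂ i) :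
    (pre (fstC k (C ⊗[k] D) E) X * Y) ((c ⊗ₜ d) ⊗ₜ e) =
      ∑ i, ∑ j, X (c₁ i ⊗ₜ d₁ j) * Y ((c₂ i ⊗ₜ d₂ j) ⊗ₜ e) := by
  rw [pre_fstC_mul_tmul _ _ _
    (reprTmul ⟨Finset.univ, c₁, c₂, h.symm⟩ ⟨Finset.univ, d₁, d₂, h'.symm⟩)]
  exact Finset.sum_product _ _ _

lemma mul_tmul_tmul_of_repr {B : Type u} [Ring B] [Algebra k B] {ι κ τ : Type*} [Fintype ι]
    [Fintype κ] [Fintype τ] (X Y : Conv k (C ⊗[k] (D ⊗[k] E)) B) {c : C} {d : D} {e : E}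
    {c₁ c₂ : ι → C} {d₁ d₂ : κ → D} {e₁ e₂ : τ → E}
    (h : comul (R := k) c = ∑ i, c₁ i ⊗ₜ[k] c₂ i) (h' : comul (R := k) d = ∑ i, d₁ i ⊗ₜ[k] d₂ i)
    (h'' : comul (R := k) e = ∑ i, e₁ i ⊗ₜ[k] e₂ i) :
    (X * Y) (c ⊗ₜ (d ⊗ₜ e)) = ∑ i, ∑ j, ∑ s,
      X (c₁ i ⊗ₜ (d₁ j ⊗ₜ e₁ s)) * Y (c₂ i ⊗ₜ (d₂ j ⊗ₜ e₂ s)) := by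
  rw [mul_tmul _ _ ⟨Finset.univ, c₁, c₂, h.symm⟩
    (reprTmul ⟨Finset.univ, d₁, d₂, h'.symm⟩ ⟨Finset.univ, e₁, e₂, h''.symm⟩)]
  exact Finset.sum_congr rfl fun i _ => Finset.sum_product _ _ _

lemma ext_tmul {B C D : Type u} [Ring B] [Algebra k B] [AddCommGroup C] [Module k C]
    [AddCommGroup D] [Module k D] {X Y : Conv k (C ⊗[k] D) B}
    (h : ∀ c d, X (c ⊗ₜ d) = Y (c ⊗ₜ d)) : X = Y :=
  WithConv.ext (TensorProduct.ext' h)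

lemma ext_tmul_tmul {B C D E : Type u} [Ring B] [Algebra k B] [AddCommGroup C] [Module k C]
    [AddCommGroup D] [Module k D] [AddCommGroup E] [Module k E] {X Y : Conv k (C ⊗[k] (D ⊗[k] E)) B}
    (h : ∀ c d e, X (c ⊗ₜ (d ⊗ₜ e)) = Y (c ⊗ₜ (d ⊗ₜ e))) : X = Y := by
  refine WithConv.ext (TensorProduct.ext (LinearMap.ext fun c => TensorProduct.ext' fun d e => ?_))
  exact h c d e

end Conv

variable (k H) in
/-- The identification `H ⊗ (H ⊗ H) → (H ⊗ H) ⊗ H`. -/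
noncomputable def assocC : H ⊗[k] (H ⊗[k] H) →ₗc[k] (H ⊗[k] H) ⊗[k] H :=
  (Coalgebra.TensorProduct.assoc k k H H H).symm.toCoalgHom

@[simp] lemma assocC_tmul (g h l : H) : assocC k H (g ⊗ₜ (h ⊗ₜ l)) = (g ⊗ₜ h) ⊗ₜ l := rfl

variable (k H) in
/-- The coalgebra map `g ⊗ h ⊗ l ↦ g ⊗ hl`. -/
noncomputable def idMulC : H ⊗[k] (H ⊗[k] H) →ₗc[k] H ⊗[k] H :=
  Coalgebra.TensorProduct.map (CoalgHom.id k H) (Bialgebra.mulCoalgHom k H)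

@[simp] lemma idMulC_tmul (g h l : H) : idMulC k H (g ⊗ₜ (h ⊗ₜ l)) = g ⊗ₜ (h * l) := rfl

variable (k H) in
/-- The coalgebra map `g ⊗ h ⊗ l ↦ gh ⊗ l`. -/
noncomputable def mulIdC : (H ⊗[k] H) ⊗[k] H →ₗc[k] H ⊗[k] H :=
  Coalgebra.TensorProduct.map (Bialgebra.mulCoalgHom k H) (CoalgHom.id k H)

@[simp] lemma mulIdC_tmul (g h l : H) : mulIdC k H ((g ⊗ₜ h) ⊗ₜ l) = (g * h) ⊗ₜ l := rfl

variable (act : H ⊗[k] A →ₗ[k] A) (f : H ⊗[k] H →ₗ[k] A)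

/-- The compatibility conditions of a crossed system, as identities in convolution algebras. -/
structure CrossedConditions : Prop where
  coalg_act : IsCoalgebraMap k act
  coalg_f : IsCoalgebraMap k f
  f_one_right : pre (inlC k H H) (toConv f : Conv k (H ⊗[k] H) A) = 1
  f_one_left : pre (inrC k H H) (toConv f : Conv k (H ⊗[k] H) A) = 1
  twisted (a : A) : actOn act (actAt act a) * (toConv f : Conv k (H ⊗[k] H) A) =
    toConv f * pre (Bialgebra.mulCoalgHom k H) (actAt act a)
  cocycle : actOn act (toConv f) * pre (idMulC k H) (toConv f : Conv k (H ⊗[k] H) A) =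
    pre (assocC k H) (pre (fstC k (H ⊗[k] H) H) (toConv f) * pre (mulIdC k H) (toConv f))
  act_comm (a : A) : Commute (post (inH k A H) (idC k H)) (post (inA k A H) (actAt act a))
  f_comm : Commute (post (inH k A H) (pre (Bialgebra.mulCoalgHom k H) (idC k H)))
    (post (inA k A H) (toConv f))

variable {act f}

lemma act_comm_iff (a : A) :
    Commute (post (inH k A H) (idC k H)) (post (inA k A H) (actAt act a)) ↔
      ∀ (g : H) (n : ℕ) (g₁ g₂ : Fin n → H),
        Coalgebra.comul (R := k) g = ∑ i, g₁ i ⊗ₜ[k] g₂ i →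
        ∑ i, g₁ i ⊗ₜ[k] act (g₂ i ⊗ₜ[k] a) = ∑ i, g₂ i ⊗ₜ[k] act (g₁ i ⊗ₜ[k] a) := by
  constructor
  · intro h g n g₁ g₂ hg
    have := congrArg (TensorProduct.comm k A H) (congrArg (fun X : Conv k H _ => X g) h.eq)
    simpa [mul_apply_of_repr _ _ hg] using this
  · intro h
    refine ext_apply fun g => ?_
    obtain ⟨n, g₁, g₂, hg⟩ := TensorProduct.exists_fin_sum (comul (R := k) g)
    apply (TensorProduct.comm k A H).injective
    simpa [mul_apply_of_repr _ _ hg] using h g n g₁ g₂ hg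

lemma f_comm_iff :
    Commute (post (inH k A H) (pre (Bialgebra.mulCoalgHom k H) (idC k H)))
      (post (inA k A H) (toConv f)) ↔
      ∀ (g h : H) (n m : ℕ) (g₁ g₂ : Fin n → H) (h₁ h₂ : Fin m → H),
        Coalgebra.comul (R := k) g = ∑ i, g₁ i ⊗ₜ[k] g₂ i →
        Coalgebra.comul (R := k) h = ∑ j, h₁ j ⊗ₜ[k] h₂ j →
        ∑ i, ∑ j, (g₁ i * h₁ j) ⊗ₜ[k] f (g₂ i ⊗ₜ[k] h₂ j) =
          ∑ i, ∑ j, (g₂ i * h₂ j) ⊗ₜ[k] f (g₁ i ⊗ₜ[k] h₁ j) := by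
  constructor
  · intro H' g h n m g₁ g₂ h₁ h₂ hg hh
    have := congrArg (TensorProduct.comm k A H)
      (congrArg (fun X : Conv k (H ⊗[k] H) _ => X (g ⊗ₜ h)) H'.eq)
    simpa [mul_tmul_of_repr _ _ hg hh] using this
  · intro H'
    refine ext_tmul fun g h => ?_
    obtain ⟨n, g₁, g₂, hg⟩ := TensorProduct.exists_fin_sum (comul (R := k) g)
    obtain ⟨m, h₁, h₂, hh⟩ := TensorProduct.exists_fin_sum (comul (R := k) h)
    apply (TensorProduct.comm k A H).injective
    simpa [mul_tmul_of_repr _ _ hg hh] using H' g h n m g₁ g₂ h₁ h₂ hg hh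

lemma twisted_iff (a : A) :
    actOn act (actAt act a) * (toConv f : Conv k (H ⊗[k] H) A) =
      toConv f * pre (Bialgebra.mulCoalgHom k H) (actAt act a) ↔
      ∀ (g h : H) (n m : ℕ) (g₁ g₂ : Fin n → H) (h₁ h₂ : Fin m → H),
        Coalgebra.comul (R := k) g = ∑ i, g₁ i ⊗ₜ[k] g₂ i →
        Coalgebra.comul (R := k) h = ∑ j, h₁ j ⊗ₜ[k] h₂ j →
        ∑ i, ∑ j, act (g₁ i ⊗ₜ[k] act (h₁ j ⊗ₜ[k] a)) * f (g₂ i ⊗ₜ[k] h₂ j) =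
          ∑ i, ∑ j, f (g₁ i ⊗ₜ[k] h₁ j) * act ((g₂ i * h₂ j) ⊗ₜ[k] a) := by
  constructor
  · intro H' g h n m g₁ g₂ h₁ h₂ hg hh
    simpa [mul_tmul_of_repr _ _ hg hh] using
      congrArg (fun X : Conv k (H ⊗[k] H) _ => X (g ⊗ₜ h)) H'
  · intro H'
    refine ext_tmul fun g h => ?_
    obtain ⟨n, g₁, g₂, hg⟩ := TensorProduct.exists_fin_sum (comul (R := k) g)
    obtain ⟨m, h₁, h₂, hh⟩ := TensorProduct.exists_fin_sum (comul (R := k) h)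
    simpa [mul_tmul_of_repr _ _ hg hh] using H' g h n m g₁ g₂ h₁ h₂ hg hh

lemma cocycle_iff :
    actOn act (toConv f) * pre (idMulC k H) (toConv f : Conv k (H ⊗[k] H) A) =
      pre (assocC k H) (pre (fstC k (H ⊗[k] H) H) (toConv f) * pre (mulIdC k H) (toConv f)) ↔
      ∀ (g h l : H) (n m r : ℕ) (g₁ g₂ : Fin n → H) (h₁ h₂ : Fin m → H)
        (l₁ l₂ : Fin r → H),
        Coalgebra.comul (R := k) g = ∑ i, g₁ i ⊗ₜ[k] g₂ i →
        Coalgebra.comul (R := k) h = ∑ j, h₁ j ⊗ₜ[k] h₂ j →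
        Coalgebra.comul (R := k) l = ∑ s, l₁ s ⊗ₜ[k] l₂ s →
        ∑ i, ∑ j, ∑ s, act (g₁ i ⊗ₜ[k] f (h₁ j ⊗ₜ[k] l₁ s)) *
            f (g₂ i ⊗ₜ[k] (h₂ j * l₂ s)) =
          ∑ i, ∑ j, f (g₁ i ⊗ₜ[k] h₁ j) * f ((g₂ i * h₂ j) ⊗ₜ[k] l) := by
  constructor
  · intro H' g h l n m r g₁ g₂ h₁ h₂ l₁ l₂ hg hh hl
    simpa [-map_mul, mul_tmul_tmul_of_repr _ _ hg hh hl,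
      pre_fstC_mul_tmul_tmul_of_repr _ _ _ hg hh] using
      congrArg (fun X : Conv k (H ⊗[k] (H ⊗[k] H)) _ => X (g ⊗ₜ (h ⊗ₜ l))) H'
  · intro H'
    refine ext_tmul_tmul fun g h l => ?_
    obtain ⟨n, g₁, g₂, hg⟩ := TensorProduct.exists_fin_sum (comul (R := k) g)
    obtain ⟨m, h₁, h₂, hh⟩ := TensorProduct.exists_fin_sum (comul (R := k) h)
    obtain ⟨r, l₁, l₂, hl⟩ := TensorProduct.exists_fin_sum (comul (R := k) l)
    simpa [-map_mul, mul_tmul_tmul_of_repr _ _ hg hh hl,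
      pre_fstC_mul_tmul_tmul_of_repr _ _ _ hg hh] using
      H' g h l n m r g₁ g₂ h₁ h₂ l₁ l₂ hg hh hl

lemma f_one_right_iff : pre (inlC k H H) (toConv f : Conv k (H ⊗[k] H) A) = 1 ↔
    ∀ h : H, f (h ⊗ₜ[k] (1 : H)) = Coalgebra.counit (R := k) h • (1 : A) :=
  ⟨fun H' h => (congrArg (fun X : Conv k H A => X h) H').trans (one_apply h),
    fun H' => ext_apply fun h => (H' h).trans (one_apply h).symm⟩

lemma f_one_left_iff : pre (inrC k H H) (toConv f : Conv k (H ⊗[k] H) A) = 1 ↔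
    ∀ h : H, f ((1 : H) ⊗ₜ[k] h) = Coalgebra.counit (R := k) h • (1 : A) :=
  ⟨fun H' h => (congrArg (fun X : Conv k H A => X h) H').trans (one_apply h),
    fun H' => ext_apply fun h => (H' h).trans (one_apply h).symm⟩

end Conditions

section CrossedMul

open Coalgebra LinearMap WithConv Conv

variable {k : Type u} [CommRing k]
variable {C : Type u} [AddCommGroup C] [Module k C] [Coalgebra k C]
variable {A : Type u} [Ring A] [HopfAlgebra k A]
variable {H : Type u} [Ring H] [HopfAlgebra k H]

variable (k A H) in
/-- The algebra map `id ⊗ ε : A ⊗ H → A`. -/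
noncomputable def projA : A ⊗[k] H →ₐ[k] A :=
  (Algebra.TensorProduct.rid k k A).toAlgHom.comp
    (Algebra.TensorProduct.map (AlgHom.id k A) (Bialgebra.counitAlgHom k H))

variable (k A H) in
/-- The algebra map `ε ⊗ id : A ⊗ H → H`. -/
noncomputable def projH : A ⊗[k] H →ₐ[k] H :=
  (Algebra.TensorProduct.lid k H).toAlgHom.comp
    (Algebra.TensorProduct.map (Bialgebra.counitAlgHom k A) (AlgHom.id k H))

@[simp] lemma projA_tmul (a : A) (h : H) : projA k A H (a ⊗ₜ h) = counit (R := k) h • a := rfl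

@[simp] lemma projH_tmul (a : A) (h : H) : projH k A H (a ⊗ₜ h) = counit (R := k) a • h := rfl

namespace Conv

@[simp] lemma post_projA_inA (X : Conv k C A) : post (projA k A H) (post (inA k A H) X) = X :=
  ext_apply fun c => by simp

@[simp] lemma post_projA_inH_pre (π : C →ₗc[k] H) :
    post (projA k A H) (post (inH k A H) (pre π (idC k H))) = 1 :=
  ext_apply fun c => by simp [Algebra.algebraMap_eq_smul_one]

@[simp] lemma post_projA_inH : post (projA k A H) (post (inH k A H) (idC k H)) = 1 :=
  ext_apply fun c => by simp [Algebra.algebraMap_eq_smul_one]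

@[simp] lemma pre_inlC_pre_fstC {B : Type u} [Ring B] [Algebra k B] (X : Conv k C B) :
    pre (inlC k C H) (pre (fstC k C H) X) = X :=
  ext_apply fun c => by simp

@[simp] lemma pre_inlC_mulCoalgHom :
    pre (inlC k H H) (pre (Bialgebra.mulCoalgHom k H) (idC k H)) = idC k H :=
  ext_apply fun c => by simp

end Conv

variable (act : H ⊗[k] A →ₗ[k] A) (f : H ⊗[k] H →ₗ[k] A)

lemma post_projA_cocycleMul : post (projA k A H) (cocycleMul f) = toConv f := by
  simp [cocycleMul]

variable {act} in
lemma smashMul_one (hact : IsWeakAction k A H act) : smashMul act f 1 = cocycleMul f := by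
  rw [smashMul, hact.actAt_one, map_one, map_one, one_mul]

variable {f} in
lemma pre_inlC_cocycleMul (hf : pre (inlC k H H) (toConv f : Conv k (H ⊗[k] H) A) = 1) :
    pre (inlC k H H) (cocycleMul f) = post (inH k A H) (idC k H) := by
  rw [cocycleMul, map_mul, pre_post, pre_post, hf, map_one, one_mul, pre_inlC_mulCoalgHom]

variable {f} in
lemma pre_inlC_smashMul (hf : pre (inlC k H H) (toConv f : Conv k (H ⊗[k] H) A) = 1) (c : A) :
    pre (inlC k H H) (smashMul act f c) =
      post (inA k A H) (actAt act c) * post (inH k A H) (idC k H) := by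
  rw [smashMul, map_mul, pre_inlC_cocycleMul hf, pre_inlC_pre_fstC]

lemma actAt_add (a b : A) : actAt act (a + b) = actAt act a + actAt act b :=
  ext_apply fun h => by simp [TensorProduct.tmul_add]

lemma actAt_smul (r : k) (a : A) : actAt act (r • a) = r • actAt act a :=
  ext_apply fun h => by simp

namespace IsCrossedMul

variable {act f} {mul : A ⊗[k] H →ₗ[k] A ⊗[k] H →ₗ[k] A ⊗[k] H}

lemma inA_mul (hm : IsCrossedMul act f mul) (a : A) (x y : A ⊗[k] H) :
    mul (inA k A H a * x) y = inA k A H a * mul x y := by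
  induction x with
  | zero => simp
  | add x x' hx hx' => rw [mul_add, map_add, LinearMap.add_apply, hx, hx', map_add,
      LinearMap.add_apply, mul_add]
  | tmul b h =>
    induction y with
    | zero => simp
    | add y y' hy hy' => rw [map_add, hy, hy', map_add, mul_add]
    | tmul c g => simp [hm _ _ _ _, ← mul_assoc]

lemma mul_one_tmul (hm : IsCrossedMul act f mul) (hact : IsWeakAction k A H act) (a : A)
    (h g : H) : mul (a ⊗ₜ h) (1 ⊗ₜ g) = inA k A H a * cocycleMul f (h ⊗ₜ g) := by
  rw [hm, smashMul_one f hact]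

lemma one_tmul_mul (hm : IsCrossedMul act f mul) (c : A) (h g : H) :
    mul (1 ⊗ₜ h) (c ⊗ₜ g) = smashMul act f c (h ⊗ₜ g) := by
  rw [hm, map_one, one_mul]

lemma one_tmul_mul_conv (hm : IsCrossedMul act f mul) (X : Conv k C A) (π : C →ₗc[k] H) (g : H)
    (t : C) :
    mul (1 ⊗ₜ g) ((post (inA k A H) X * post (inH k A H) (pre π (idC k H))) t) =
      (post (inA k A H) (actOn act X) *
        pre (Coalgebra.TensorProduct.map (CoalgHom.id k H) π) (cocycleMul f)) (g ⊗ₜ t) := by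
  rw [mul_tmul _ _ (ℛ k g) (ℛ k t), (ℛ k t).convMul_apply, map_sum, Finset.sum_comm]
  refine Finset.sum_congr rfl fun j _ => ?_
  have : post (inA k A H) X ((ℛ k t).left j) *
      post (inH k A H) (pre π (idC k H)) ((ℛ k t).right j) =
      X ((ℛ k t).left j) ⊗ₜ π ((ℛ k t).right j) := by simp
  rw [this, hm.one_tmul_mul, smashMul, pre_fstC_mul_tmul _ _ _ (ℛ k g)]
  rfl

lemma conv_mul_tmul (hm : IsCrossedMul act f mul) (X : Conv k C A) (π : C →ₗc[k] H) (c : A) (l : H)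
    (t : C) :
    mul ((post (inA k A H) X * post (inH k A H) (pre π (idC k H))) t) (c ⊗ₜ l) =
      (pre (fstC k C H) (post (inA k A H) X) *
        pre (Coalgebra.TensorProduct.map π (CoalgHom.id k H)) (smashMul act f c)) (t ⊗ₜ l) := by
  rw [pre_fstC_mul_tmul _ _ _ (ℛ k t), (ℛ k t).convMul_apply, map_sum, LinearMap.sum_apply]
  refine Finset.sum_congr rfl fun j _ => ?_
  have : post (inA k A H) X ((ℛ k t).left j) *
      post (inH k A H) (pre π (idC k H)) ((ℛ k t).right j) =
      X ((ℛ k t).left j) ⊗ₜ π ((ℛ k t).right j) := by simp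
  rw [this, hm]
  rfl

end IsCrossedMul

end CrossedMul

section Necessity

open Coalgebra LinearMap WithConv Conv

variable {k : Type u} [CommRing k]
variable {C : Type u} [AddCommGroup C] [Module k C] [Coalgebra k C]
variable {A : Type u} [Ring A] [HopfAlgebra k A]
variable {H : Type u} [Ring H] [HopfAlgebra k H]
variable {act : H ⊗[k] A →ₗ[k] A} {f : H ⊗[k] H →ₗ[k] A}
  {mul : A ⊗[k] H →ₗ[k] A ⊗[k] H →ₗ[k] A ⊗[k] H}

lemma HopfAlgebraOn.comul_mul_map₂ {V : Type u} [AddCommGroup V] [Module k V] [Coalgebra k V]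
    (hs : HopfAlgebraOn k V) (x y : V) :
    comul (R := k) (hs.mul x y) =
      TensorProduct.map₂ hs.mul hs.mul (comul (R := k) x) (comul (R := k) y) := by
  obtain ⟨n, x₁, x₂, hx⟩ := TensorProduct.exists_fin_sum (comul (R := k) x)
  obtain ⟨m, y₁, y₂, hy⟩ := TensorProduct.exists_fin_sum (comul (R := k) y)
  rw [hs.comul_mul x y n m x₁ x₂ y₁ y₂ hx hy, hx, hy, Finset.sum_comm]
  simp

lemma comul_one_tmul {ι : Type*} {h : H} (R : Repr k h ι) :
    comul (R := k) ((1 : A) ⊗ₜ[k] h) =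
      ∑ i ∈ R.index, (1 ⊗ₜ R.left i) ⊗ₜ[k] (1 ⊗ₜ R.right i) := by
  rw [TensorProduct.comul_tmul, ← R.eq]
  simp [TensorProduct.tmul_sum, Algebra.TensorProduct.one_def]

lemma comul_tmul_one {ι : Type*} {a : A} (R : Repr k a ι) :
    comul (R := k) (a ⊗ₜ[k] (1 : H)) =
      ∑ i ∈ R.index, (R.left i ⊗ₜ 1) ⊗ₜ[k] (R.right i ⊗ₜ 1) := by
  rw [TensorProduct.comul_tmul, ← R.eq]
  simp [TensorProduct.sum_tmul, Algebra.TensorProduct.one_def]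

variable (k) in
/-- The algebra inclusion of the first factor. -/
noncomputable abbrev inFst (B B' : Type u) [Ring B] [Algebra k B] [Ring B'] [Algebra k B'] :
    B →ₐ[k] B ⊗[k] B' :=
  Algebra.TensorProduct.includeLeft

variable (k) in
/-- The algebra inclusion of the second factor. -/
noncomputable abbrev inSnd (B B' : Type u) [Ring B] [Algebra k B] [Ring B'] [Algebra k B'] :
    B' →ₐ[k] B ⊗[k] B' :=
  Algebra.TensorProduct.includeRight

namespace IsCrossedMul

lemma comul_smashMul_tmul (hm : IsCrossedMul act f mul) {ι : Type*} {c : A} (R : Repr k c ι)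
    (h g : H) :
    TensorProduct.map₂ mul mul (comul (R := k) (1 ⊗ₜ[k] h)) (comul (R := k) (c ⊗ₜ[k] g)) =
      ∑ i ∈ R.index, (post (inFst k (A ⊗[k] H) (A ⊗[k] H)) (smashMul act f (R.left i)) *
        post (inSnd k (A ⊗[k] H) (A ⊗[k] H)) (smashMul act f (R.right i))) (h ⊗ₜ g) := by
  simp_rw [mul_tmul _ _ (ℛ k h) (ℛ k g)]
  rw [comul_one_tmul (ℛ k h), ← (reprTmul R (ℛ k g)).eq, map_sum]
  refine (Finset.sum_product _ _ _).trans (Finset.sum_congr rfl fun i _ => ?_)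
  rw [Finset.sum_comm]
  refine Finset.sum_congr rfl fun j _ => ?_
  simp [reprTmul, hm.one_tmul_mul]

lemma post_comul_smashMul (hm : IsCrossedMul act f mul)
    (hc : ∀ x y, comul (R := k) (mul x y) =
      TensorProduct.map₂ mul mul (comul (R := k) x) (comul (R := k) y))
    {ι : Type*} {c : A} (R : Repr k c ι) :
    post (Bialgebra.comulAlgHom k (A ⊗[k] H)) (smashMul act f c) =
      ∑ i ∈ R.index, post (inFst k (A ⊗[k] H) (A ⊗[k] H)) (smashMul act f (R.left i)) *
        post (inSnd k (A ⊗[k] H) (A ⊗[k] H)) (smashMul act f (R.right i)) := by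
  refine ext_tmul fun h g => ?_
  rw [post_apply, ← hm.one_tmul_mul, Bialgebra.comulAlgHom_apply, hc, hm.comul_smashMul_tmul R]
  simp only [WithConv.ofConv_sum, LinearMap.sum_apply]

end IsCrossedMul

variable (k A H) in
/-- The algebra map `(a # h) ⊗ (b # g) ↦ ε(h)a ⊗ ε(g)b`. -/
noncomputable def projAA : (A ⊗[k] H) ⊗[k] (A ⊗[k] H) →ₐ[k] A ⊗[k] A :=
  Algebra.TensorProduct.map (projA k A H) (projA k A H)

variable (k A H) in
/-- The algebra map `(a # h) ⊗ (b # g) ↦ ε(a)ε(g)b # h`. -/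
noncomputable def projHA : (A ⊗[k] H) ⊗[k] (A ⊗[k] H) →ₐ[k] A ⊗[k] H :=
  (Algebra.TensorProduct.comm k H A).toAlgHom.comp
    (Algebra.TensorProduct.map (projH k A H) (projA k A H))

lemma projAA_tmul (x y : A ⊗[k] H) :
    projAA k A H (x ⊗ₜ y) = projA k A H x ⊗ₜ projA k A H y := rfl

lemma projHA_tmul (x y : A ⊗[k] H) :
    projHA k A H (x ⊗ₜ y) = projA k A H y ⊗ₜ projH k A H x := rfl

@[simp] lemma post_projH_inA_of_counit {X : Conv k C A} {r : k}
    (h : ∀ c, counit (R := k) (X c) = r * counit (R := k) c) :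
    post (projH k A H) (post (inA k A H) X) = r • 1 :=
  ext_apply fun c => by
    rw [Conv.smul_apply, Conv.one_apply, smul_smul, ← h]
    simp

@[simp] lemma post_projH_inH (X : Conv k C H) : post (projH k A H) (post (inH k A H) X) = X :=
  ext_apply fun c => by simp

lemma projA_counit (x : A ⊗[k] H) : counit (R := k) (projA k A H x) = counit (R := k) x := by
  induction x with
  | zero => simp
  | add x y hx hy => simp [hx, hy]
  | tmul a h => simp [mul_comm]

lemma projAA_comp_comul : (projAA k A H).comp (Bialgebra.comulAlgHom k (A ⊗[k] H)) =
    (Bialgebra.comulAlgHom k A).comp (projA k A H) := by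
  ext x
  · change projAA k A H (comul (R := k) (x ⊗ₜ[k] (1 : H))) = _
    rw [comul_tmul_one (ℛ k x)]
    simp [projAA_tmul, (ℛ k x).eq]
  · change projAA k A H (comul (R := k) ((1 : A) ⊗ₜ[k] x)) = _
    rw [comul_one_tmul (ℛ k x)]
    conv_rhs => simp [← sum_counit_smul (ℛ k x)]
    simp [projAA_tmul, Algebra.TensorProduct.one_def, TensorProduct.smul_tmul', smul_smul,
      mul_comm]

lemma projHA_comp_comul : (projHA k A H).comp (Bialgebra.comulAlgHom k (A ⊗[k] H)) =
    AlgHom.id k _ := by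
  ext x
  · change projHA k A H (comul (R := k) (x ⊗ₜ[k] (1 : H))) = x ⊗ₜ 1
    rw [comul_tmul_one (ℛ k x)]
    conv_rhs => rw [← sum_counit_smul (ℛ k x)]
    simp [projHA_tmul, TensorProduct.sum_tmul, TensorProduct.smul_tmul']
  · change projHA k A H (comul (R := k) ((1 : A) ⊗ₜ[k] x)) = 1 ⊗ₜ x
    rw [comul_one_tmul (ℛ k x)]
    conv_rhs => rw [← sum_counit_smul_right (ℛ k x)]
    simp [projHA_tmul, TensorProduct.tmul_sum, TensorProduct.smul_tmul']

namespace IsCrossedMul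

/-- The first component of the twisted multiplication, `h ⊗ g ↦ (h₁ ▷ c) f(h₂, g)`. -/
noncomputable def smashA (act : H ⊗[k] A →ₗ[k] A) (f : H ⊗[k] H →ₗ[k] A) (c : A) :
    Conv k (H ⊗[k] H) A :=
  pre (fstC k H H) (actAt act c) * toConv f

lemma smashMul_eq (c : A) : smashMul act f c = post (inA k A H) (smashA act f c) *
    post (inH k A H) (pre (Bialgebra.mulCoalgHom k H) (idC k H)) := by
  rw [smashMul, cocycleMul, smashA, map_mul, mul_assoc, pre_post]

lemma post_projA_smashMul (c : A) : post (projA k A H) (smashMul act f c) = smashA act f c := by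
  rw [smashMul_eq, map_mul, post_projA_inA, post_projA_inH_pre, mul_one]

lemma smashA_one (hact : IsWeakAction k A H act) : smashA act f 1 = toConv f := by
  rw [smashA, hact.actAt_one, map_one, one_mul]

lemma pre_inlC_smashA (hf : pre (inlC k H H) (toConv f : Conv k (H ⊗[k] H) A) = 1) (c : A) :
    pre (inlC k H H) (smashA act f c) = actAt act c := by
  rw [smashA, map_mul, hf, mul_one, pre_inlC_pre_fstC]

lemma counit_smashA (hm : IsCrossedMul act f mul)
    (hc : ∀ x y, counit (R := k) (mul x y) = counit (R := k) x * counit (R := k) y) (c : A)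
    (h g : H) : counit (R := k) (smashA act f c (h ⊗ₜ g)) =
      counit (R := k) c * (counit (R := k) h * counit (R := k) g) := by
  rw [← post_projA_smashMul, post_apply, projA_counit, ← hm.one_tmul_mul, hc]
  simp only [TensorProduct.counit_tmul, Bialgebra.counit_one, smul_eq_mul]
  ring

lemma post_comul_smashA (hm : IsCrossedMul act f mul)
    (hc : ∀ x y, comul (R := k) (mul x y) =
      TensorProduct.map₂ mul mul (comul (R := k) x) (comul (R := k) y))
    {ι : Type*} {c : A} (R : Repr k c ι) :
    post (Bialgebra.comulAlgHom k A) (smashA act f c) =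
      ∑ i ∈ R.index, post (inFst k A A) (smashA act f (R.left i)) *
        post (inSnd k A A) (smashA act f (R.right i)) := by
  have := congrArg (post (projAA k A H)) (hm.post_comul_smashMul hc R)
  rw [post_post, projAA_comp_comul, ← post_post, post_projA_smashMul, map_sum] at this
  rw [this]
  refine Finset.sum_congr rfl fun i _ => ?_
  rw [map_mul, post_post, post_post, ← post_projA_smashMul, ← post_projA_smashMul, post_post,
    post_post]
  congr 2
  · congr 1; ext <;> simp [projAA_tmul, TensorProduct.smul_tmul']
  · congr 1; ext <;> simp [projAA_tmul]

lemma smashMul_eq_mul_smashA (hm : IsCrossedMul act f mul)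
    (hc : ∀ x y, counit (R := k) (mul x y) = counit (R := k) x * counit (R := k) y)
    (hc' : ∀ x y, comul (R := k) (mul x y) =
      TensorProduct.map₂ mul mul (comul (R := k) x) (comul (R := k) y)) (c : A) :
    smashMul act f c = post (inH k A H) (pre (Bialgebra.mulCoalgHom k H) (idC k H)) *
      post (inA k A H) (smashA act f c) := by
  have hl : ∀ c, post (projHA k A H) (post (inFst k (A ⊗[k] H) (A ⊗[k] H)) (smashMul act f c)) =
      counit (R := k) c • post (inH k A H) (pre (Bialgebra.mulCoalgHom k H) (idC k H)) := by
    intro c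
    have e : (projHA k A H).comp (inFst k (A ⊗[k] H) (A ⊗[k] H)) =
        (inH k A H).comp (projH k A H) := by
      ext <;> simp [projHA_tmul]
    rw [post_post, e, ← post_post, smashMul_eq, map_mul, post_projH_inH,
      post_projH_inA_of_counit (r := counit (R := k) c), smul_mul_assoc, one_mul]
    · exact ext_apply fun t => by simp
    · intro t
      induction t with
      | zero => simp
      | add x y hx hy => rw [map_add, map_add, map_add, mul_add, hx, hy]
      | tmul h g => rw [hm.counit_smashA hc, TensorProduct.counit_tmul, smul_eq_mul,
          mul_comm (counit (R := k) g)]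
  have hr : ∀ c, post (projHA k A H) (post (inSnd k (A ⊗[k] H) (A ⊗[k] H)) (smashMul act f c)) =
      post (inA k A H) (smashA act f c) := by
    intro c
    have e : (projHA k A H).comp (inSnd k (A ⊗[k] H) (A ⊗[k] H)) =
        (inA k A H).comp (projA k A H) := by
      ext <;> simp [projHA_tmul, TensorProduct.smul_tmul']
    rw [post_post, e, ← post_post, post_projA_smashMul]
  have := congrArg (post (projHA k A H)) (hm.post_comul_smashMul hc' (ℛ k c))
  rw [post_post, projHA_comp_comul, map_sum] at this
  simp_rw [map_mul, hl, hr, smul_mul_assoc, ← mul_smul_comm, ← Finset.mul_sum] at this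
  refine this.trans (congrArg _ ?_)
  refine ext_tmul fun h g => ?_
  conv_rhs => rw [smashA, post_apply, pre_fstC_mul_tmul _ _ _ (ℛ k h), ← sum_counit_smul (ℛ k c)]
  simp only [WithConv.ofConv_sum, LinearMap.sum_apply, Conv.smul_apply, post_apply, smashA,
    pre_fstC_mul_tmul _ _ _ (ℛ k h), actAt_apply, TensorProduct.tmul_sum, TensorProduct.tmul_smul,
    map_sum, map_smul, Finset.sum_mul, Finset.smul_sum, smul_mul_assoc]
  exact Finset.sum_comm

lemma f_comm (hm : IsCrossedMul act f mul) (hact : IsWeakAction k A H act)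
    (hc : ∀ x y, counit (R := k) (mul x y) = counit (R := k) x * counit (R := k) y)
    (hc' : ∀ x y, comul (R := k) (mul x y) =
      TensorProduct.map₂ mul mul (comul (R := k) x) (comul (R := k) y)) :
    Commute (post (inH k A H) (pre (Bialgebra.mulCoalgHom k H) (idC k H)))
      (post (inA k A H) (toConv f)) := by
  have := hm.smashMul_eq_mul_smashA hc hc' 1
  rw [smashMul_eq, smashA_one hact] at this
  exact this.symm

lemma act_comm (hm : IsCrossedMul act f mul)
    (hc : ∀ x y, counit (R := k) (mul x y) = counit (R := k) x * counit (R := k) y)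
    (hc' : ∀ x y, comul (R := k) (mul x y) =
      TensorProduct.map₂ mul mul (comul (R := k) x) (comul (R := k) y))
    (hf : pre (inlC k H H) (toConv f : Conv k (H ⊗[k] H) A) = 1) (c : A) :
    Commute (post (inH k A H) (idC k H)) (post (inA k A H) (actAt act c)) := by
  have := congrArg (pre (inlC k H H)) (hm.smashMul_eq_mul_smashA hc hc' c)
  rw [pre_inlC_smashMul act hf, map_mul, pre_post, pre_post, pre_inlC_smashA hf,
    pre_inlC_mulCoalgHom] at this
  exact this.symm

lemma coalg_f (hm : IsCrossedMul act f mul) (hact : IsWeakAction k A H act)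
    (hc : ∀ x y, counit (R := k) (mul x y) = counit (R := k) x * counit (R := k) y)
    (hc' : ∀ x y, comul (R := k) (mul x y) =
      TensorProduct.map₂ mul mul (comul (R := k) x) (comul (R := k) y)) :
    IsCoalgebraMap k f := by
  constructor
  · have := hm.post_comul_smashA hc' (c := 1) ⟨{()}, fun _ => 1, fun _ => 1, by
      simp [Algebra.TensorProduct.one_def]⟩
    rw [Finset.sum_singleton, smashA_one hact] at this
    refine TensorProduct.ext' fun h g => ?_
    rw [LinearMap.comp_apply, LinearMap.comp_apply, ← (reprTmul (ℛ k h) (ℛ k g)).eq]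
    refine (congrArg (fun X : Conv k (H ⊗[k] H) _ => X (h ⊗ₜ g)) this).trans ?_
    refine ((reprTmul (ℛ k h) (ℛ k g)).convMul_apply _ _).trans ?_
    simp
  · refine TensorProduct.ext' fun h g => ?_
    have := hm.counit_smashA hc 1 h g
    rw [smashA_one hact, Bialgebra.counit_one, one_mul] at this
    rw [TensorProduct.counit_tmul, smul_eq_mul, mul_comm]
    exact this

lemma coalg_act (hm : IsCrossedMul act f mul)
    (hc : ∀ x y, counit (R := k) (mul x y) = counit (R := k) x * counit (R := k) y)
    (hc' : ∀ x y, comul (R := k) (mul x y) =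
      TensorProduct.map₂ mul mul (comul (R := k) x) (comul (R := k) y))
    (hf : pre (inlC k H H) (toConv f : Conv k (H ⊗[k] H) A) = 1) :
    IsCoalgebraMap k act := by
  have key : ∀ c h, act (h ⊗ₜ c) = smashA act f c (h ⊗ₜ 1) := fun c h =>
    congrArg (fun X : Conv k H A => X h) (pre_inlC_smashA (act := act) hf c).symm
  constructor
  · refine TensorProduct.ext' fun h c => ?_
    have := congrArg (pre (inlC k H H)) (hm.post_comul_smashA hc' (ℛ k c))
    rw [pre_post, pre_inlC_smashA hf, map_sum] at this
    simp_rw [map_mul, pre_post, pre_inlC_smashA hf] at this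
    rw [LinearMap.comp_apply, LinearMap.comp_apply, ← (reprTmul (ℛ k h) (ℛ k c)).eq]
    refine (congrArg (fun X : Conv k H _ => X h) this).trans ?_
    simp only [WithConv.ofConv_sum, LinearMap.sum_apply, (ℛ k h).convMul_apply, map_sum]
    refine Eq.trans ?_ (Finset.sum_product_right _ _ _).symm
    simp [reprTmul]
  · refine TensorProduct.ext' fun h c => ?_
    rw [LinearMap.comp_apply, key, hm.counit_smashA hc]
    simp

lemma f_one_right (hm : IsCrossedMul act f mul) (hact : IsWeakAction k A H act)
    (h1 : ∀ x, mul x (1 ⊗ₜ 1) = x) :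
    pre (inlC k H H) (toConv f : Conv k (H ⊗[k] H) A) = 1 := by
  rw [← post_projA_cocycleMul f, pre_post, ← post_projA_inH (k := k)]
  congr 1
  refine ext_apply fun h => ?_
  have := hm.mul_one_tmul hact 1 h 1
  rw [h1, map_one, one_mul] at this
  exact this.symm

lemma f_one_left (hm : IsCrossedMul act f mul) (hact : IsWeakAction k A H act)
    (h1 : ∀ x, mul (1 ⊗ₜ 1) x = x) :
    pre (inrC k H H) (toConv f : Conv k (H ⊗[k] H) A) = 1 := by
  rw [← post_projA_cocycleMul f, pre_post, ← post_projA_inH (k := k)]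
  congr 1
  refine ext_apply fun h => ?_
  have := hm.mul_one_tmul hact 1 1 h
  rw [h1, map_one, one_mul] at this
  exact this.symm

lemma twisted (hm : IsCrossedMul act f mul) (hact : IsWeakAction k A H act)
    (ha : ∀ x y z, mul (mul x y) z = mul x (mul y z))
    (hf : pre (inlC k H H) (toConv f : Conv k (H ⊗[k] H) A) = 1) (a : A) :
    actOn act (actAt act a) * (toConv f : Conv k (H ⊗[k] H) A) =
      toConv f * pre (Bialgebra.mulCoalgHom k H) (actAt act a) := by
  have key : post (inA k A H) (actOn act (actAt act a)) * cocycleMul f =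
      post (inA k A H) (toConv f) * pre (Bialgebra.mulCoalgHom k H)
        (post (inA k A H) (actAt act a) * post (inH k A H) (idC k H)) := by
    refine ext_tmul fun g h => ?_
    have e := ha (1 ⊗ₜ g) (1 ⊗ₜ h) (a ⊗ₜ 1)
    rw [hm.mul_one_tmul hact, map_one, one_mul, cocycleMul, hm.conv_mul_tmul, hm.one_tmul_mul] at e
    have e' : smashMul act f a (h ⊗ₜ 1) = (post (inA k A H) (actAt act a) *
        post (inH k A H) (pre (CoalgHom.id k H) (idC k H))) h :=
      congrArg (fun X : Conv k H _ => X h) (pre_inlC_smashMul act hf a)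
    rw [e', hm.one_tmul_mul_conv] at e
    refine Eq.trans ?_ (e.symm.trans ?_)
    · congr 3
      exact ext_tmul fun _ _ => rfl
    · rw [← pre_inlC_smashMul act hf]
      refine (congrArg (fun X : Conv k (H ⊗[k] H) _ => X (g ⊗ₜ h))
        (map_mul (pre (inlC k (H ⊗[k] H) H)) _ _)).trans ?_
      rw [pre_inlC_pre_fstC]
      rfl
  have := congrArg (post (projA k A H)) key
  rwa [map_mul, map_mul, post_projA_inA, post_projA_inA, post_projA_cocycleMul, ← pre_post, map_mul,
    post_projA_inA, post_projA_inH, mul_one] at this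

lemma cocycle (hm : IsCrossedMul act f mul) (hact : IsWeakAction k A H act)
    (ha : ∀ x y z, mul (mul x y) z = mul x (mul y z)) :
    actOn act (toConv f) * pre (idMulC k H) (toConv f : Conv k (H ⊗[k] H) A) =
      pre (assocC k H) (pre (fstC k (H ⊗[k] H) H) (toConv f) * pre (mulIdC k H) (toConv f)) := by
  have key : post (inA k A H) (actOn act (toConv f)) * pre (idMulC k H) (cocycleMul f) =
      pre (assocC k H) (pre (fstC k (H ⊗[k] H) H) (post (inA k A H) (toConv f)) *
        pre (mulIdC k H) (cocycleMul f)) := by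
    refine ext_tmul_tmul fun g h l => ?_
    have e := ha (1 ⊗ₜ g) (1 ⊗ₜ h) (1 ⊗ₜ l)
    rw [hm.mul_one_tmul hact, hm.mul_one_tmul hact, map_one, one_mul, one_mul] at e
    conv_lhs at e => rw [cocycleMul]
    conv_rhs at e => rw [cocycleMul]
    rw [hm.conv_mul_tmul, hm.one_tmul_mul_conv, smashMul_one f hact] at e
    exact e.symm
  have := congrArg (post (projA k A H)) key
  rwa [map_mul, ← pre_post, ← pre_post, map_mul, post_projA_inA, ← pre_post, ← pre_post,
    post_projA_inA, post_projA_cocycleMul] at this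

end IsCrossedMul

lemma CrossedConditions.of_hopfAlgebraOn (hact : IsWeakAction k A H act)
    (hs : HopfAlgebraOn k (A ⊗[k] H)) (h1 : hs.one = 1 ⊗ₜ 1)
    (hm : CrossedProductMul k A H hs act f) : CrossedConditions act f := by
  rw [crossedProductMul_iff] at hm
  have hf := hm.f_one_right hact fun x => by rw [← h1, hs.mul_one]
  exact
  { coalg_act := hm.coalg_act hs.counit_mul hs.comul_mul_map₂ hf
    coalg_f := hm.coalg_f hact hs.counit_mul hs.comul_mul_map₂
    f_one_right := hf
    f_one_left := hm.f_one_left hact fun x => by rw [← h1, hs.one_mul]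
    twisted := hm.twisted hact hs.mul_assoc hf
    cocycle := hm.cocycle hact hs.mul_assoc
    act_comm := hm.act_comm hs.counit_mul hs.comul_mul_map₂ hf
    f_comm := hm.f_comm hact hs.counit_mul hs.comul_mul_map₂ }

end Necessity

section Sufficiency

open Coalgebra LinearMap WithConv Conv

variable {k : Type u} [CommRing k]
variable {C : Type u} [AddCommGroup C] [Module k C] [Coalgebra k C]
variable {A : Type u} [Ring A] [HopfAlgebra k A]
variable {H : Type u} [Ring H] [HopfAlgebra k H]

section Mul

variable (act : H ⊗[k] A →ₗ[k] A) (f : H ⊗[k] H →ₗ[k] A)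

lemma smashMul_add (a b : A) : smashMul act f (a + b) = smashMul act f a + smashMul act f b := by
  simp [smashMul, actAt_add, add_mul]

lemma smashMul_smul (r : k) (a : A) : smashMul act f (r • a) = r • smashMul act f a := by
  have : pre (fstC k H H) (post (inA k A H) (actAt act (r • a))) =
      r • pre (fstC k H H) (post (inA k A H) (actAt act a)) :=
    ext_apply fun h => by simp [actAt_smul]
  rw [smashMul, this, smul_mul_assoc, smashMul]

/-- The crossed product multiplication. -/
noncomputable def crossedMul : A ⊗[k] H →ₗ[k] A ⊗[k] H →ₗ[k] A ⊗[k] H :=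
  TensorProduct.lift <| LinearMap.mk₂ k
    (fun a h => TensorProduct.lift <| LinearMap.mk₂ k
      (fun c g => inA k A H a * smashMul act f c (h ⊗ₜ g))
      (fun c c' g => by simp only [smashMul_add, Conv.add_apply, mul_add])
      (fun r c g => by simp only [smashMul_smul, Conv.smul_apply, mul_smul_comm])
      (fun c g g' => by simp only [TensorProduct.tmul_add, map_add, mul_add])
      (fun r c g => by simp only [TensorProduct.tmul_smul, map_smul, mul_smul_comm]))
    (fun a a' h => TensorProduct.ext' fun c g => by
      simp only [LinearMap.add_apply, TensorProduct.lift.tmul, mk₂_apply, map_add, add_mul])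
    (fun r a h => TensorProduct.ext' fun c g => by
      simp only [LinearMap.smul_apply, TensorProduct.lift.tmul, mk₂_apply, map_smul,
        smul_mul_assoc])
    (fun a h h' => TensorProduct.ext' fun c g => by
      simp only [LinearMap.add_apply, TensorProduct.lift.tmul, mk₂_apply, TensorProduct.add_tmul,
        map_add, mul_add])
    (fun r a h => TensorProduct.ext' fun c g => by
      simp only [LinearMap.smul_apply, TensorProduct.lift.tmul, mk₂_apply,
        ← TensorProduct.smul_tmul', map_smul, mul_smul_comm])

lemma isCrossedMul_crossedMul : IsCrossedMul act f (crossedMul act f) := fun _ _ _ _ => rfl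

end Mul

variable {act : H ⊗[k] A →ₗ[k] A} {f : H ⊗[k] H →ₗ[k] A}
  {mul : A ⊗[k] H →ₗ[k] A ⊗[k] H →ₗ[k] A ⊗[k] H}

lemma pre_inrC_mulCoalgHom :
    pre (inrC k H H) (pre (Bialgebra.mulCoalgHom k H) (idC k H)) = idC k H :=
  ext_apply fun c => by simp

namespace IsCrossedMul

lemma mul_one (hm : IsCrossedMul act f mul) (hact : IsWeakAction k A H act)
    (hf : pre (inlC k H H) (toConv f : Conv k (H ⊗[k] H) A) = 1) (x : A ⊗[k] H) :
    mul x (1 ⊗ₜ 1) = x := by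
  induction x with
  | zero => simp
  | add x y hx hy => rw [map_add, LinearMap.add_apply, hx, hy]
  | tmul a h =>
    rw [hm.mul_one_tmul hact]
    refine (congrArg (fun X : Conv k H _ => _ * X h) (pre_inlC_cocycleMul hf)).trans ?_
    simp

lemma one_mul (hm : IsCrossedMul act f mul) (hact : IsWeakAction k A H act)
    (hf : pre (inrC k H H) (toConv f : Conv k (H ⊗[k] H) A) = 1) (x : A ⊗[k] H) :
    mul (1 ⊗ₜ 1) x = x := by
  induction x with
  | zero => simp
  | add x y hx hy => rw [map_add, hx, hy]
  | tmul a h =>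
    have : pre (inrC k H H) (cocycleMul f) = post (inH k A H) (idC k H) := by
      rw [cocycleMul, map_mul, pre_post, pre_post, hf, map_one, _root_.one_mul,
        pre_inrC_mulCoalgHom]
    rw [hm.one_tmul_mul, smashMul, pre_fstC_mul_tmul _ _ _ ⟨{()}, fun _ => 1, fun _ => 1, by
      simp [Algebra.TensorProduct.one_def]⟩, Finset.sum_singleton]
    refine (congrArg (fun X : Conv k H _ => _ * X h) this).trans ?_
    simp [hact.2.1]

lemma mul_assoc_of_conditions (hm : IsCrossedMul act f mul) (hact : IsWeakAction k A H act)
    (hc : CrossedConditions act f) (x y z : A ⊗[k] H) :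
    mul (mul x y) z = mul x (mul y z) := by
  induction x with
  | zero => simp
  | add x x' hx hx' => simp only [map_add, LinearMap.add_apply, hx, hx']
  | tmul a g =>
  induction y with
  | zero => simp
  | add x x' hx hx' => simp only [map_add, LinearMap.add_apply, hx, hx']
  | tmul b h =>
  induction z with
  | zero => simp
  | add x x' hx hx' => simp only [map_add, hx, hx']
  | tmul c l =>
  have e : a ⊗ₜ[k] g = inA k A H a * (1 ⊗ₜ g) := by simp
  rw [e, hm.inA_mul, hm.inA_mul, hm.inA_mul]
  congr 1
  let X : Conv k (H ⊗[k] H) A := toConv (LinearMap.mulLeft k b ∘ₗ (smashA act f c).ofConv)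
  have e₁ : mul (b ⊗ₜ h) (c ⊗ₜ l) = (post (inA k A H) X *
      post (inH k A H) (pre (Bialgebra.mulCoalgHom k H) (idC k H))) (h ⊗ₜ l) := by
    rw [hm, smashMul_eq, mul_tmul _ _ (ℛ k h) (ℛ k l), mul_tmul _ _ (ℛ k h) (ℛ k l)]
    simp [X, Finset.mul_sum]
  have e₂ : actOn act X = pre (fstC k H (H ⊗[k] H)) (actAt act b) * actOn act (smashA act f c) := by
    refine ext_tmul fun g t => ?_
    obtain ⟨n, g₁, g₂, hg⟩ := TensorProduct.exists_fin_sum (comul (R := k) g)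
    rw [pre_fstC_mul_tmul _ _ _ ⟨Finset.univ, g₁, g₂, hg.symm⟩]
    exact hact.2.2 g b _ n g₁ g₂ hg
  have e₃ : pre (fstC k H (H ⊗[k] H)) (actAt act b) =
      pre (assocC k H) (pre (fstC k (H ⊗[k] H) H) (pre (fstC k H H) (actAt act b))) :=
    ext_tmul_tmul fun g h l => by simp [smul_smul]
  have e₄ : actOn act (pre (fstC k H H) (actAt act c)) =
      pre (assocC k H) (pre (fstC k (H ⊗[k] H) H) (actOn act (actAt act c))) :=
    ext_tmul_tmul fun g h l => by simp
  have e₅ : pre (idMulC k H) (pre (Bialgebra.mulCoalgHom k H) (idC k H)) =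
      pre (assocC k H) (pre (mulIdC k H) (pre (Bialgebra.mulCoalgHom k H) (idC k H))) :=
    ext_tmul_tmul fun g h l => by simp [mul_assoc]
  rw [hm.one_tmul_mul, smashMul_eq, hm.conv_mul_tmul, e₁, hm.one_tmul_mul_conv]
  have e₆ : pre (mulIdC k H) (smashA act f c) = pre (fstC k (H ⊗[k] H) H)
      (pre (Bialgebra.mulCoalgHom k H) (actAt act c)) * pre (mulIdC k H) (toConv f) := by
    rw [smashA, map_mul]
    congr 1
    refine WithConv.ext
      (TensorProduct.ext (TensorProduct.ext' fun g h => LinearMap.ext fun l => ?_))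
    simp
  have e₇ : actOn act X * pre (idMulC k H) (toConv f) = pre (assocC k H)
      (pre (fstC k (H ⊗[k] H) H) (smashA act f b) * pre (mulIdC k H) (smashA act f c)) := by
    rw [e₆, e₂, smashA, smashA, hact.actOn_mul, e₃, e₄, mul_assoc, mul_assoc, hc.cocycle,
      ← map_mul, ← map_mul]
    congr 1
    rw [map_mul, ← mul_assoc (pre _ (actOn act _)), ← map_mul, hc.twisted, map_mul]
    simp only [mul_assoc]
  have key : post (inA k A H) (actOn act X) * pre (idMulC k H) (cocycleMul f) =
      pre (assocC k H) (pre (fstC k (H ⊗[k] H) H) (post (inA k A H) (smashA act f b)) *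
        pre (mulIdC k H) (smashMul act f c)) := by
    rw [cocycleMul, map_mul (pre (idMulC k H)), pre_post, pre_post, e₅, ← mul_assoc,
      ← map_mul (post (inA k A H)), e₇, smashMul_eq, map_mul (pre (mulIdC k H)),
      pre_post (mulIdC k H), pre_post (mulIdC k H), pre_post, ← mul_assoc,
      ← map_mul (post (inA k A H)), map_mul (pre (assocC k H)) (post _ _), pre_post, pre_post]
  exact (congrArg (fun Y : Conv k (H ⊗[k] (H ⊗[k] H)) _ => Y (g ⊗ₜ (h ⊗ₜ l))) key).symm

end IsCrossedMul

end Sufficiency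

section Coalgebra

open Coalgebra LinearMap WithConv Conv

variable {k : Type u} [CommRing k]
variable {C D : Type u} [AddCommGroup C] [Module k C] [Coalgebra k C]
  [AddCommGroup D] [Module k D] [Coalgebra k D]
variable {A : Type u} [Ring A] [HopfAlgebra k A]
variable {H : Type u} [Ring H] [HopfAlgebra k H]
variable {act : H ⊗[k] A →ₗ[k] A} {f : H ⊗[k] H →ₗ[k] A}
  {mul : A ⊗[k] H →ₗ[k] A ⊗[k] H →ₗ[k] A ⊗[k] H}

namespace IsCoalgebraMap

variable {B : Type u} [Ring B] [HopfAlgebra k B]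

lemma post_comul {φ : C →ₗ[k] B} (hφ : IsCoalgebraMap k φ) :
    post (Bialgebra.comulAlgHom k B) (toConv φ) =
      post (inFst k B B) (toConv φ) * post (inSnd k B B) (toConv φ) := by
  refine ext_apply fun c => ?_
  rw [(ℛ k c).convMul_apply]
  refine (LinearMap.congr_fun hφ.1 c).trans ?_
  rw [LinearMap.comp_apply, ← (ℛ k c).eq]
  simp

lemma post_counit {φ : C →ₗ[k] B} (hφ : IsCoalgebraMap k φ) :
    post (Bialgebra.counitAlgHom k B) (toConv φ) = 1 :=
  ext_apply fun c => (LinearMap.congr_fun hφ.2 c).trans (by simp)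

lemma post_comul_actAt (hφ : IsCoalgebraMap k act) {ι : Type*} {c : A} (R : Repr k c ι) :
    post (Bialgebra.comulAlgHom k A) (actAt act c) = ∑ i ∈ R.index,
      post (inFst k A A) (actAt act (R.left i)) * post (inSnd k A A) (actAt act (R.right i)) := by
  refine ext_apply fun h => ?_
  simp only [WithConv.ofConv_sum, LinearMap.sum_apply, (ℛ k h).convMul_apply]
  refine (LinearMap.congr_fun hφ.1 (h ⊗ₜ c)).trans ?_
  rw [LinearMap.comp_apply, ← (reprTmul (ℛ k h) R).eq, map_sum]
  refine (Finset.sum_product_right _ _ _).trans ?_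
  simp [reprTmul]

lemma post_counit_actAt (hφ : IsCoalgebraMap k act) (c : A) :
    post (Bialgebra.counitAlgHom k A) (actAt act c) = counit (R := k) c • 1 :=
  ext_apply fun h => (LinearMap.congr_fun hφ.2 (h ⊗ₜ c)).trans (by simp)

end IsCoalgebraMap

lemma comulAlgHom_comp_inA : (Bialgebra.comulAlgHom k (A ⊗[k] H)).comp (inA k A H) =
    (Algebra.TensorProduct.map (inA k A H) (inA k A H)).comp (Bialgebra.comulAlgHom k A) := by
  ext a
  refine (comul_tmul_one (ℛ k a)).trans ?_
  simp [← (ℛ k a).eq]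

lemma comulAlgHom_comp_inH : (Bialgebra.comulAlgHom k (A ⊗[k] H)).comp (inH k A H) =
    (Algebra.TensorProduct.map (inH k A H) (inH k A H)).comp (Bialgebra.comulAlgHom k H) := by
  ext a
  refine (comul_one_tmul (ℛ k a)).trans ?_
  simp [← (ℛ k a).eq]

lemma post_comul_idC (π : C →ₗc[k] H) : post (Bialgebra.comulAlgHom k H) (pre π (idC k H)) =
    post (inFst k H H) (pre π (idC k H)) * post (inSnd k H H) (pre π (idC k H)) :=
  IsCoalgebraMap.post_comul (φ := π.toLinearMap) ⟨π.map_comp_comul.symm, π.counit_comp⟩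

variable (k A H) in
/-- The algebra map `a # h ↦ (1 # h) ⊗ (a # 1)`. -/
noncomputable def swapIncl : A ⊗[k] H →ₐ[k] (A ⊗[k] H) ⊗[k] (A ⊗[k] H) :=
  (Algebra.TensorProduct.comm k (A ⊗[k] H) (A ⊗[k] H)).toAlgHom.comp
    (Algebra.TensorProduct.map (inA k A H) (inH k A H))

/-- Maps whose images commute pointwise give commuting convolution factors on `C ⊗ D`. -/
lemma commute_pre_fstC_pre_sndC {B : Type u} [Ring B] [Algebra k B] (X : Conv k C B)
    (Y : Conv k D B) (h : ∀ c d, Commute (X c) (Y d)) :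
    Commute (pre (fstC k C D) X) (pre (sndC k C D) Y) := by
  refine ext_tmul fun c d => ?_
  have e₁ : X c * Y d = ∑ i ∈ (ℛ k c).index, X ((ℛ k c).left i) *
      (counit (R := k) ((ℛ k c).right i) • Y d) := by
    conv_lhs => rw [← sum_counit_smul_right (ℛ k c)]
    simp [Finset.sum_mul]
  have e₂ : Y d * X c = ∑ i ∈ (ℛ k c).index, (counit (R := k) ((ℛ k c).left i) • Y d) *
      X ((ℛ k c).right i) := by
    conv_lhs => rw [← sum_counit_smul (ℛ k c)]
    simp [Finset.mul_sum]
  rw [pre_fstC_mul_tmul _ _ _ (ℛ k c), mul_pre_fstC_tmul _ _ _ (ℛ k c)]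
  simp_rw [pre_apply, sndC_tmul, map_smul]
  rw [← e₁, ← e₂]
  exact h c d

lemma pre_mulCoalgHom_idC : pre (Bialgebra.mulCoalgHom k H) (idC k H) =
    pre (fstC k H H) (idC k H) * pre (sndC k H H) (idC k H) := by
  refine ext_tmul fun h g => ?_
  rw [pre_fstC_mul_tmul _ _ _ (ℛ k h)]
  simp only [pre_apply, sndC_tmul, idC_apply, mul_smul_comm]
  simp only [← smul_mul_assoc, ← Finset.sum_mul, sum_counit_smul_right]
  simp

namespace CrossedConditions

lemma act_comm_mul (hc : CrossedConditions act f) (a : A) :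
    Commute (post (inH k A H) (pre (Bialgebra.mulCoalgHom k H) (idC k H)))
      (pre (fstC k H H) (post (inA k A H) (actAt act a))) := by
  rw [pre_mulCoalgHom_idC, map_mul]
  refine Commute.mul_left ?_ ?_
  · exact (hc.act_comm a).map (pre (fstC k H H))
  · refine (commute_pre_fstC_pre_sndC _ (post (inH k A H) (idC k H)) fun c d => ?_).symm
    simp [Commute, SemiconjBy]

lemma act_comm_f (hc : CrossedConditions act f) (a : A) :
    Commute (pre (fstC k H H) (post (inSnd k A A) (actAt act a)))
      (post (inFst k A A) (toConv f)) := by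
  refine ext_tmul fun h g => ?_
  rw [pre_fstC_mul_tmul _ _ _ (ℛ k h), mul_pre_fstC_tmul _ _ _ (ℛ k h)]
  have := congrArg (fun X : Conv k H _ => X h) (hc.act_comm a).eq
  simp only [(ℛ k h).convMul_apply] at this
  have := congrArg ((TensorProduct.comm k A A).toLinearMap ∘ₗ
    TensorProduct.map LinearMap.id (f ∘ₗ (TensorProduct.mk k H H).flip g)) this.symm
  simpa using this

lemma post_comul_smashMul (hc : CrossedConditions act f) {ι : Type*} {c : A} (R : Repr k c ι) :
    post (Bialgebra.comulAlgHom k (A ⊗[k] H)) (smashMul act f c) =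
      ∑ i ∈ R.index, post (inFst k (A ⊗[k] H) (A ⊗[k] H)) (smashMul act f (R.left i)) *
        post (inSnd k (A ⊗[k] H) (A ⊗[k] H)) (smashMul act f (R.right i)) := by
  let I := inFst k (A ⊗[k] H) (A ⊗[k] H)
  let J := inSnd k (A ⊗[k] H) (A ⊗[k] H)
  let F₁ := post (I.comp (inA k A H)) (toConv f)
  let F₂ := post (J.comp (inA k A H)) (toConv f)
  let M₁ := post (I.comp (inH k A H)) (pre (Bialgebra.mulCoalgHom k H) (idC k H))
  let M₂ := post (J.comp (inH k A H)) (pre (Bialgebra.mulCoalgHom k H) (idC k H))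
  let a₁ (a : A) := pre (fstC k H H) (post (I.comp (inA k A H)) (actAt act a))
  let a₂ (a : A) := pre (fstC k H H) (post (J.comp (inA k A H)) (actAt act a))
  have hA₁ : (Algebra.TensorProduct.map (inA k A H) (inA k A H)).comp (inFst k A A) =
      I.comp (inA k A H) := by
    ext; simp [I, Algebra.TensorProduct.one_def]
  have hA₂ : (Algebra.TensorProduct.map (inA k A H) (inA k A H)).comp (inSnd k A A) =
      J.comp (inA k A H) := by
    ext; simp [J, Algebra.TensorProduct.one_def]
  have hH₁ : (Algebra.TensorProduct.map (inH k A H) (inH k A H)).comp (inFst k H H) =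
      I.comp (inH k A H) := by
    ext; simp [I, Algebra.TensorProduct.one_def]
  have hH₂ : (Algebra.TensorProduct.map (inH k A H) (inH k A H)).comp (inSnd k H H) =
      J.comp (inH k A H) := by
    ext; simp [J, Algebra.TensorProduct.one_def]
  have hS₁ : (swapIncl k A H).comp (inA k A H) = J.comp (inA k A H) := by
    ext; simp [swapIncl, J, Algebra.TensorProduct.one_def]
  have hS₂ : (swapIncl k A H).comp (inH k A H) = I.comp (inH k A H) := by
    ext; simp [swapIncl, I, Algebra.TensorProduct.one_def]
  have hF : post (Bialgebra.comulAlgHom k (A ⊗[k] H)) (post (inA k A H) (toConv f)) = F₁ * F₂ := by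
    rw [post_post, comulAlgHom_comp_inA, ← post_post, hc.coalg_f.post_comul, map_mul, post_post,
      post_post, hA₁, hA₂]
  have hM : post (Bialgebra.comulAlgHom k (A ⊗[k] H)) (post (inH k A H)
      (pre (Bialgebra.mulCoalgHom k H) (idC k H))) = M₁ * M₂ := by
    rw [post_post, comulAlgHom_comp_inH, ← post_post, post_comul_idC, map_mul, post_post,
      post_post, hH₁, hH₂]
  have ha : post (Bialgebra.comulAlgHom k (A ⊗[k] H)) (pre (fstC k H H) (post (inA k A H)
      (actAt act c))) = ∑ i ∈ R.index, a₁ (R.left i) * a₂ (R.right i) := by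
    rw [← pre_post, post_post, comulAlgHom_comp_inA, ← post_post, hc.coalg_act.post_comul_actAt R,
      map_sum, map_sum]
    simp only [map_mul, post_post, hA₁, hA₂]
    rfl
  have hFM : F₂ * M₁ = M₁ * F₂ := by
    have := hc.f_comm.map (post (swapIncl k A H))
    rw [post_post, post_post, hS₁, hS₂] at this
    exact this.symm
  have haM (a : A) : a₂ a * M₁ = M₁ * a₂ a := by
    have : Commute (post ((swapIncl k A H).comp (inH k A H))
        (pre (Bialgebra.mulCoalgHom k H) (idC k H))) (pre (fstC k H H)
        (post ((swapIncl k A H).comp (inA k A H)) (actAt act a))) :=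
      (hc.act_comm_mul a).map (post (swapIncl k A H))
    rw [hS₁, hS₂] at this
    exact this.symm
  have haF (a : A) : a₂ a * F₁ = F₁ * a₂ a := by
    let φ := Algebra.TensorProduct.map (inA k A H) (inA k A H)
    have : Commute (pre (fstC k H H) (post (φ.comp (inSnd k A A)) (actAt act a)))
        (post (φ.comp (inFst k A A)) (toConv f)) := (hc.act_comm_f a).map (post φ)
    rw [hA₁, hA₂] at this
    exact this
  rw [smashMul, cocycleMul, map_mul, map_mul, hF, hM, ha, Finset.sum_mul]
  refine Finset.sum_congr rfl fun i _ => ?_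
  calc a₁ (R.left i) * a₂ (R.right i) * (F₁ * F₂ * (M₁ * M₂))
      = a₁ (R.left i) * (a₂ (R.right i) * F₁) * (F₂ * M₁) * M₂ := by simp only [mul_assoc]
    _ = a₁ (R.left i) * F₁ * (a₂ (R.right i) * M₁) * F₂ * M₂ := by
      rw [haF, hFM]; simp only [mul_assoc]
    _ = (a₁ (R.left i) * (F₁ * M₁)) * (a₂ (R.right i) * (F₂ * M₂)) := by
      rw [haM]; simp only [mul_assoc]
    _ = _ := by
      rw [smashMul, cocycleMul, smashMul, cocycleMul, map_mul, map_mul, map_mul, map_mul]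
      rfl

lemma post_counit_smashMul (hc : CrossedConditions act f) (c : A) :
    post (Bialgebra.counitAlgHom k (A ⊗[k] H)) (smashMul act f c) = counit (R := k) c • 1 := by
  have eA : (Bialgebra.counitAlgHom k (A ⊗[k] H)).comp (inA k A H) =
      Bialgebra.counitAlgHom k A := by
    ext; simp
  have eH : (Bialgebra.counitAlgHom k (A ⊗[k] H)).comp (inH k A H) =
      Bialgebra.counitAlgHom k H := by
    ext; simp
  have h1 : post (Bialgebra.counitAlgHom k H) (pre (Bialgebra.mulCoalgHom k H) (idC k H)) = 1 :=
    ext_tmul fun g h => by simp [mul_comm]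
  rw [smashMul, cocycleMul, map_mul, map_mul, ← pre_post, post_post, post_post, post_post, eA, eH,
    hc.coalg_f.post_counit, hc.coalg_act.post_counit_actAt, h1, mul_one, mul_one]
  exact ext_apply fun t => by
    simp only [pre_apply, Conv.smul_apply, Conv.one_apply, CoalgHomClass.counit_comp_apply]

end CrossedConditions

namespace IsCrossedMul

lemma counit_mul (hm : IsCrossedMul act f mul) (hc : CrossedConditions act f) (x y : A ⊗[k] H) :
    counit (R := k) (mul x y) = counit (R := k) x * counit (R := k) y := by
  induction x with
  | zero => simp
  | add x x' hx hx' => simp only [map_add, LinearMap.add_apply, hx, hx', add_mul]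
  | tmul a h =>
  induction y with
  | zero => simp
  | add x x' hx hx' => simp only [map_add, hx, hx', mul_add]
  | tmul c g =>
    have := congrArg (fun X : Conv k (H ⊗[k] H) _ => X (h ⊗ₜ g)) (hc.post_counit_smashMul c)
    simp only [post_apply, Bialgebra.counitAlgHom_apply, Conv.smul_apply, Conv.one_apply,
      TensorProduct.counit_tmul, smul_eq_mul] at this
    rw [hm, Bialgebra.counit_mul, this]
    simp only [Algebra.TensorProduct.includeLeft_apply, TensorProduct.counit_tmul,
      Bialgebra.counit_one, smul_eq_mul]
    ring

lemma map₂_mul (hm : IsCrossedMul act f mul) (u : A ⊗[k] A)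
    (x y : (A ⊗[k] H) ⊗[k] (A ⊗[k] H)) :
    TensorProduct.map₂ mul mul (Algebra.TensorProduct.map (inA k A H) (inA k A H) u * x) y =
      Algebra.TensorProduct.map (inA k A H) (inA k A H) u * TensorProduct.map₂ mul mul x y := by
  induction u with
  | zero => simp
  | add x x' hx hx' => simp only [map_add, add_mul, LinearMap.add_apply, hx, hx']
  | tmul a b =>
  induction x with
  | zero => simp
  | add x x' hx hx' => simp only [map_add, mul_add, LinearMap.add_apply, hx, hx']
  | tmul x x' =>
  induction y with
  | zero => simp
  | add x x' hx hx' => simp only [map_add, mul_add, hx, hx']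
  | tmul y y' =>
    rw [Algebra.TensorProduct.map_tmul, Algebra.TensorProduct.tmul_mul_tmul,
      TensorProduct.map₂_apply_tmul, TensorProduct.map₂_apply_tmul, TensorProduct.map_tmul,
      TensorProduct.map_tmul, Algebra.TensorProduct.tmul_mul_tmul, hm.inA_mul, hm.inA_mul]

lemma comul_mul (hm : IsCrossedMul act f mul) (hc : CrossedConditions act f) (x y : A ⊗[k] H) :
    comul (R := k) (mul x y) =
      TensorProduct.map₂ mul mul (comul (R := k) x) (comul (R := k) y) := by
  induction x with
  | zero => simp
  | add x x' hx hx' => simp only [map_add, LinearMap.add_apply, hx, hx']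
  | tmul a h =>
  induction y with
  | zero => simp
  | add x x' hx hx' => simp only [map_add, hx, hx']
  | tmul c g =>
    have e : a ⊗ₜ[k] h = inA k A H a * (1 ⊗ₜ h) := by simp
    have ea : comul (R := k) (inA k A H a) = Algebra.TensorProduct.map (inA k A H) (inA k A H)
        (comul (R := k) a) := AlgHom.congr_fun comulAlgHom_comp_inA a
    have h1 := congrArg (fun X : Conv k (H ⊗[k] H) _ => X (h ⊗ₜ g)) (hc.post_comul_smashMul (ℛ k c))
    simp only [WithConv.ofConv_sum, LinearMap.sum_apply] at h1
    rw [e, hm.inA_mul, Bialgebra.comul_mul, Bialgebra.comul_mul, ea, hm.map₂_mul,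
      hm.comul_smashMul_tmul (ℛ k c), hm.one_tmul_mul, ← h1]
    rfl

end IsCrossedMul

end Coalgebra

section Antipode

open Coalgebra LinearMap WithConv Conv

variable {k : Type u} [CommRing k]
variable {C : Type u} [AddCommGroup C] [Module k C] [Coalgebra k C]
variable {A : Type u} [Ring A] [HopfAlgebra k A]
variable {H : Type u} [Ring H] [HopfAlgebra k H]

namespace Conv

lemma mul_apply_arbitrary {B : Type u} [Ring B] [Algebra k B] (X Y : Conv k C B) (c : C) :
    (X * Y) c = ∑ i ∈ (ℛ k c).index, X ((ℛ k c).left i) * Y ((ℛ k c).right i) :=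
  (ℛ k c).convMul_apply _ _

variable (k H) in
/-- The antipode of `H`, as an element of the convolution algebra. -/
def antipodeC : Conv k H H := toConv (HopfAlgebra.antipode k)

@[simp] lemma antipodeC_apply (h : H) : antipodeC k H h = HopfAlgebra.antipode k h := rfl

lemma antipodeC_mul_idC : antipodeC k H * idC k H = 1 :=
  ext_apply fun h => by
    rw [mul_apply_arbitrary]
    exact (HopfAlgebra.sum_antipode_mul_eq_smul (ℛ k h)).trans (one_apply h).symm

lemma idC_mul_antipodeC : idC k H * antipodeC k H = 1 :=
  ext_apply fun h => by
    rw [mul_apply_arbitrary]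
    exact (HopfAlgebra.sum_mul_antipode_eq_smul (ℛ k h)).trans (one_apply h).symm

variable {B : Type u} [Ring B] [Bialgebra k B] {e : H →ₐ[k] B}

lemma post_comul_post_idC (he : (Bialgebra.comulAlgHom k B).comp e =
    (Algebra.TensorProduct.map e e).comp (Bialgebra.comulAlgHom k H)) :
    post (Bialgebra.comulAlgHom k B) (post e (idC k H)) =
      post ((inFst k B B).comp e) (idC k H) * post ((inSnd k B B).comp e) (idC k H) := by
  have h₁ : (Algebra.TensorProduct.map e e).comp (inFst k H H) = (inFst k B B).comp e := by
    ext; simp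
  have h₂ : (Algebra.TensorProduct.map e e).comp (inSnd k H H) = (inSnd k B B).comp e := by
    ext; simp
  have := congrArg (post (Algebra.TensorProduct.map e e)) (post_comul_idC (CoalgHom.id k H))
  rw [map_mul] at this
  rw [post_post, he, ← h₁, ← h₂]
  exact this

lemma post_comul_post_antipodeC (he : (Bialgebra.comulAlgHom k B).comp e =
    (Algebra.TensorProduct.map e e).comp (Bialgebra.comulAlgHom k H)) :
    post (Bialgebra.comulAlgHom k B) (post e (antipodeC k H)) =
      post ((inSnd k B B).comp e) (antipodeC k H) *
        post ((inFst k B B).comp e) (antipodeC k H) := by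
  refine left_inv_eq_right_inv (a := post (Bialgebra.comulAlgHom k B) (post e (idC k H))) ?_ ?_
  · rw [← map_mul, ← map_mul, antipodeC_mul_idC, map_one, map_one]
  · rw [post_comul_post_idC he, mul_assoc, ← mul_assoc (post ((inSnd k B B).comp e) _), ← map_mul,
      idC_mul_antipodeC, map_one, one_mul, ← map_mul, idC_mul_antipodeC, map_one]

variable (k H) in
/-- The map `g ↦ S(g₁) ⊗ g₂`. -/
noncomputable def antipodeTmulId : Conv k H (H ⊗[k] H) :=
  post (inA k H H) (antipodeC k H) * post (inH k H H) (idC k H)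

variable (k H) in
/-- The map `g ↦ g₁ ⊗ S(g₂)`. -/
noncomputable def idTmulAntipode : Conv k H (H ⊗[k] H) :=
  post (inA k H H) (idC k H) * post (inH k H H) (antipodeC k H)

@[simp] lemma mulCoalgHom_antipodeTmulId (g : H) :
    Bialgebra.mulCoalgHom k H (antipodeTmulId k H g) = counit (R := k) g • 1 := by
  rw [← one_apply, ← antipodeC_mul_idC, antipodeTmulId, mul_apply_arbitrary, mul_apply_arbitrary]
  simp

@[simp] lemma mulCoalgHom_idTmulAntipode (g : H) :
    Bialgebra.mulCoalgHom k H (idTmulAntipode k H g) = counit (R := k) g • 1 := by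
  rw [← one_apply, ← idC_mul_antipodeC, idTmulAntipode, mul_apply_arbitrary, mul_apply_arbitrary]
  simp

lemma post_comul_inA_antipodeC :
    post (Bialgebra.comulAlgHom k (H ⊗[k] H)) (post (inA k H H) (antipodeC k H)) =
      post ((inSnd k (H ⊗[k] H) (H ⊗[k] H)).comp (inA k H H)) (antipodeC k H) *
        post ((inFst k (H ⊗[k] H) (H ⊗[k] H)).comp (inA k H H)) (antipodeC k H) :=
  post_comul_post_antipodeC comulAlgHom_comp_inA

lemma post_comul_inH_idC :
    post (Bialgebra.comulAlgHom k (H ⊗[k] H)) (post (inH k H H) (idC k H)) =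
      post ((inFst k (H ⊗[k] H) (H ⊗[k] H)).comp (inH k H H)) (idC k H) *
        post ((inSnd k (H ⊗[k] H) (H ⊗[k] H)).comp (inH k H H)) (idC k H) :=
  post_comul_post_idC comulAlgHom_comp_inH

/-- `Δ(S(g₁) ⊗ g₂) = (S(g₂) ⊗ g₃) ⊗ (S(g₁) ⊗ g₄)`. -/
lemma post_comul_antipodeTmulId :
    post (Bialgebra.comulAlgHom k (H ⊗[k] H)) (antipodeTmulId k H) =
      post ((inSnd k (H ⊗[k] H) (H ⊗[k] H)).comp (inA k H H)) (antipodeC k H) *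
        post (inFst k (H ⊗[k] H) (H ⊗[k] H)) (antipodeTmulId k H) *
        post ((inSnd k (H ⊗[k] H) (H ⊗[k] H)).comp (inH k H H)) (idC k H) := by
  rw [antipodeTmulId, map_mul, map_mul, post_comul_inA_antipodeC, post_comul_inH_idC]
  simp only [mul_assoc]
  rfl

lemma mul_antipodeTmulId (X Y : Conv k (H ⊗[k] H) B) (g : H) :
    (X * Y) (antipodeTmulId k H g) = ∑ i ∈ (ℛ k g).index, ∑ j ∈ (ℛ k ((ℛ k g).left i)).index,
      X (antipodeTmulId k H ((ℛ k ((ℛ k g).left i)).right j)) *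
        Y (HopfAlgebra.antipode k ((ℛ k ((ℛ k g).left i)).left j) ⊗ₜ (ℛ k g).right i) := by
  refine (convMul_apply _ _ _).trans ((congrArg (fun Z : Conv k H _ =>
    mul' k B (TensorProduct.map X.ofConv Y.ofConv (Z g))) post_comul_antipodeTmulId).trans ?_)
  simp only [mul_apply_arbitrary, Finset.sum_mul, map_sum]
  exact Finset.sum_congr rfl fun i _ => Finset.sum_congr rfl fun j _ => by simp

end Conv

end Antipode

section AntipodeTriple

open Coalgebra LinearMap WithConv Conv

variable {k : Type u} [CommRing k]
variable {H : Type u} [Ring H] [HopfAlgebra k H]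

namespace Conv

variable {B : Type u} [Ring B] [Algebra k B]

lemma post_comul_inA_idC :
    post (Bialgebra.comulAlgHom k (H ⊗[k] H)) (post (inA k H H) (idC k H)) =
      post ((inFst k (H ⊗[k] H) (H ⊗[k] H)).comp (inA k H H)) (idC k H) *
        post ((inSnd k (H ⊗[k] H) (H ⊗[k] H)).comp (inA k H H)) (idC k H) :=
  post_comul_post_idC comulAlgHom_comp_inA

lemma post_comul_inH_antipodeC :
    post (Bialgebra.comulAlgHom k (H ⊗[k] H)) (post (inH k H H) (antipodeC k H)) =
      post ((inSnd k (H ⊗[k] H) (H ⊗[k] H)).comp (inH k H H)) (antipodeC k H) *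
        post ((inFst k (H ⊗[k] H) (H ⊗[k] H)).comp (inH k H H)) (antipodeC k H) :=
  post_comul_post_antipodeC comulAlgHom_comp_inH

/-- `Δ(g₁ ⊗ S(g₂)) = (g₁ ⊗ S(g₄)) ⊗ (g₂ ⊗ S(g₃))`. -/
lemma post_comul_idTmulAntipode :
    post (Bialgebra.comulAlgHom k (H ⊗[k] H)) (idTmulAntipode k H) =
      post ((inFst k (H ⊗[k] H) (H ⊗[k] H)).comp (inA k H H)) (idC k H) *
        (post (inSnd k (H ⊗[k] H) (H ⊗[k] H)) (idTmulAntipode k H) *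
          post ((inFst k (H ⊗[k] H) (H ⊗[k] H)).comp (inH k H H)) (antipodeC k H)) := by
  rw [idTmulAntipode, map_mul, map_mul, post_comul_inA_idC, post_comul_inH_antipodeC]
  simp only [mul_assoc]
  rfl

lemma mul_idTmulAntipode (X Y : Conv k (H ⊗[k] H) B) (g : H) :
    (X * Y) (idTmulAntipode k H g) = ∑ i ∈ (ℛ k g).index, ∑ j ∈ (ℛ k ((ℛ k g).right i)).index,
      X ((ℛ k g).left i ⊗ₜ HopfAlgebra.antipode k ((ℛ k ((ℛ k g).right i)).right j)) *
        Y (idTmulAntipode k H ((ℛ k ((ℛ k g).right i)).left j)) := by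
  refine (convMul_apply _ _ _).trans ((congrArg (fun Z : Conv k H _ =>
    mul' k B (TensorProduct.map X.ofConv Y.ofConv (Z g))) post_comul_idTmulAntipode).trans ?_)
  simp only [mul_apply_arbitrary, Finset.mul_sum, map_sum]
  exact Finset.sum_congr rfl fun i _ => Finset.sum_congr rfl fun j _ => by simp

variable (k H) in
/-- The map `g ↦ g₁ ⊗ S(g₂) ⊗ g₃`. -/
noncomputable def idTmulAntipodeTmulId : Conv k H (H ⊗[k] (H ⊗[k] H)) :=
  post (inA k H (H ⊗[k] H)) (idC k H) * post (inH k H (H ⊗[k] H)) (antipodeTmulId k H)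

lemma comulAlgHom_comp_inA_tmul : (Bialgebra.comulAlgHom k (H ⊗[k] (H ⊗[k] H))).comp
    (inA k H (H ⊗[k] H)) = (Algebra.TensorProduct.map (inA k H (H ⊗[k] H))
      (inA k H (H ⊗[k] H))).comp (Bialgebra.comulAlgHom k H) :=
  comulAlgHom_comp_inA

lemma comulAlgHom_comp_inH_tmul : (Bialgebra.comulAlgHom k (H ⊗[k] (H ⊗[k] H))).comp
    (inH k H (H ⊗[k] H)) = (Algebra.TensorProduct.map (inH k H (H ⊗[k] H))
      (inH k H (H ⊗[k] H))).comp (Bialgebra.comulAlgHom k (H ⊗[k] H)) :=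
  comulAlgHom_comp_inH

lemma post_comul_inA_idC_tmul :
    post (Bialgebra.comulAlgHom k (H ⊗[k] (H ⊗[k] H))) (post (inA k H (H ⊗[k] H)) (idC k H)) =
      post ((inFst k (H ⊗[k] (H ⊗[k] H)) (H ⊗[k] (H ⊗[k] H))).comp (inA k H (H ⊗[k] H)))
        (idC k H) *
      post ((inSnd k (H ⊗[k] (H ⊗[k] H)) (H ⊗[k] (H ⊗[k] H))).comp (inA k H (H ⊗[k] H)))
        (idC k H) :=
  post_comul_post_idC comulAlgHom_comp_inA_tmul

/-- `Δ(g₁ ⊗ S(g₂) ⊗ g₃) = (g₁ ⊗ S(g₄) ⊗ g₅) ⊗ (g₂ ⊗ S(g₃) ⊗ g₆)`. -/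
lemma post_comul_idTmulAntipodeTmulId :
    post (Bialgebra.comulAlgHom k (H ⊗[k] (H ⊗[k] H))) (idTmulAntipodeTmulId k H) =
      post ((inFst k (H ⊗[k] (H ⊗[k] H)) (H ⊗[k] (H ⊗[k] H))).comp (inA k H (H ⊗[k] H)))
          (idC k H) *
        (post ((inSnd k (H ⊗[k] (H ⊗[k] H)) (H ⊗[k] (H ⊗[k] H))).comp
            (Algebra.TensorProduct.map (AlgHom.id k H) (inA k H H))) (idTmulAntipode k H) *
          (post ((inFst k (H ⊗[k] (H ⊗[k] H)) (H ⊗[k] (H ⊗[k] H))).comp (inH k H (H ⊗[k] H)))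
              (antipodeTmulId k H) *
            post ((inSnd k (H ⊗[k] (H ⊗[k] H)) (H ⊗[k] (H ⊗[k] H))).comp
              ((inH k H (H ⊗[k] H)).comp (inH k H H))) (idC k H))) := by
  let I := inFst k (H ⊗[k] (H ⊗[k] H)) (H ⊗[k] (H ⊗[k] H))
  let J := inSnd k (H ⊗[k] (H ⊗[k] H)) (H ⊗[k] (H ⊗[k] H))
  let Φ := Algebra.TensorProduct.map (inH k H (H ⊗[k] H)) (inH k H (H ⊗[k] H))
  have h₁ : Φ.comp (inFst k _ _) = I.comp (inH k H (H ⊗[k] H)) := by ext <;> simp [Φ, I]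
  have h₂ : Φ.comp ((inSnd k _ _).comp (inA k H H)) =
      J.comp ((Algebra.TensorProduct.map (AlgHom.id k H) (inA k H H)).comp (inH k H H)) := by
    ext; simp [Φ, J, Algebra.TensorProduct.one_def]
  have h₃ : Φ.comp ((inSnd k _ _).comp (inH k H H)) =
      J.comp ((inH k H (H ⊗[k] H)).comp (inH k H H)) := by
    ext; simp [Φ, J, Algebra.TensorProduct.one_def]
  let K := J.comp (Algebra.TensorProduct.map (AlgHom.id k H) (inA k H H))
  have e₁ : post (Bialgebra.comulAlgHom k (H ⊗[k] (H ⊗[k] H)))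
      (post (inH k H (H ⊗[k] H)) (antipodeTmulId k H)) =
      post K (post (inH k H H) (antipodeC k H)) *
        post (I.comp (inH k H (H ⊗[k] H))) (antipodeTmulId k H) *
        post (J.comp ((inH k H (H ⊗[k] H)).comp (inH k H H))) (idC k H) := by
    rw [post_post, comulAlgHom_comp_inH_tmul, ← post_post, post_comul_antipodeTmulId, map_mul,
      map_mul, post_post, post_post, post_post, post_post, h₁, h₂, h₃]
    rfl
  have e₂ : post (J.comp (inA k H (H ⊗[k] H))) (idC k H) = post K (post (inA k H H) (idC k H)) :=
    ext_apply fun h => by simp [K, Algebra.TensorProduct.one_def]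
  rw [idTmulAntipodeTmulId, map_mul, post_comul_inA_idC_tmul, e₁,
    idTmulAntipode, map_mul, e₂]
  simp only [mul_assoc]
  rfl

lemma mul_idTmulAntipodeTmulId (X Y : Conv k (H ⊗[k] (H ⊗[k] H)) B) (g : H) :
    (X * Y) (idTmulAntipodeTmulId k H g) =
      ∑ i ∈ (ℛ k g).index, ∑ j ∈ (ℛ k ((ℛ k g).right i)).index,
        ∑ l ∈ (ℛ k ((ℛ k ((ℛ k g).right i)).right j)).index,
          X ((ℛ k g).left i ⊗ₜ
            antipodeTmulId k H ((ℛ k ((ℛ k ((ℛ k g).right i)).right j)).left l)) *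
          Y (TensorProduct.assoc k H H H (idTmulAntipode k H ((ℛ k ((ℛ k g).right i)).left j) ⊗ₜ
            (ℛ k ((ℛ k ((ℛ k g).right i)).right j)).right l)) := by
  refine (convMul_apply _ _ _).trans ((congrArg (fun Z : Conv k H _ =>
    mul' k B (TensorProduct.map X.ofConv Y.ofConv (Z g)))
      post_comul_idTmulAntipodeTmulId).trans ?_)
  simp only [mul_apply_arbitrary, Finset.mul_sum, map_sum]
  refine Finset.sum_congr rfl fun i _ => Finset.sum_congr rfl fun j _ =>
    Finset.sum_congr rfl fun l _ => ?_
  simp only [post_apply]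
  generalize idTmulAntipode k H _ = u
  induction u with
  | zero => simp
  | add x y hx hy => simp only [map_add, mul_add, add_mul, TensorProduct.add_tmul, hx, hy]
  | tmul x y => simp

end Conv

end AntipodeTriple

section CocycleAntipode

open Coalgebra LinearMap WithConv Conv

variable {k : Type u} [CommRing k]
variable {C : Type u} [AddCommGroup C] [Module k C] [Coalgebra k C]
variable {A : Type u} [Ring A] [HopfAlgebra k A]
variable {H : Type u} [Ring H] [HopfAlgebra k H]
variable {act : H ⊗[k] A →ₗ[k] A} {f : H ⊗[k] H →ₗ[k] A}

namespace IsCoalgebraMap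

lemma antipode_comp_mul {φ : C →ₗ[k] A} (hφ : IsCoalgebraMap k φ) :
    (toConv (HopfAlgebra.antipode k ∘ₗ φ) * toConv φ : Conv k C A) = 1 := by
  let π : C →ₗc[k] A := ⟨φ, hφ.2, hφ.1.symm⟩
  have := congrArg (pre π) (antipodeC_mul_idC (k := k) (H := A))
  rwa [map_mul, map_one] at this

lemma mul_antipode_comp {φ : C →ₗ[k] A} (hφ : IsCoalgebraMap k φ) :
    (toConv φ * toConv (HopfAlgebra.antipode k ∘ₗ φ) : Conv k C A) = 1 := by
  let π : C →ₗc[k] A := ⟨φ, hφ.2, hφ.1.symm⟩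
  have := congrArg (pre π) (idC_mul_antipodeC (k := k) (H := A))
  rwa [map_mul, map_one] at this

end IsCoalgebraMap

namespace CrossedConditions

lemma actOn_antipode_comp_mul (hact : IsWeakAction k A H act) (hc : CrossedConditions act f) :
    actOn act (toConv (HopfAlgebra.antipode k ∘ₗ f)) *
        pre (assocC k H) (pre (fstC k (H ⊗[k] H) H) (toConv f)) =
      pre (idMulC k H) (toConv f : Conv k (H ⊗[k] H) A) *
        pre (assocC k H) (pre (mulIdC k H) (toConv (HopfAlgebra.antipode k ∘ₗ f))) := by
  have hP : actOn act (toConv (HopfAlgebra.antipode k ∘ₗ f)) * actOn act (toConv f) = 1 := by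
    rw [← hact.actOn_mul, hc.coalg_f.antipode_comp_mul, hact.actOn_one]
  have hT : pre (assocC k H) (pre (mulIdC k H) (toConv f)) * pre (assocC k H) (pre (mulIdC k H)
      (toConv (HopfAlgebra.antipode k ∘ₗ f) : Conv k (H ⊗[k] H) A)) = 1 := by
    rw [← map_mul, ← map_mul, hc.coalg_f.mul_antipode_comp, map_one, map_one]
  rw [← one_mul (pre (idMulC k H) _), ← hP, mul_assoc (actOn act _), hc.cocycle, map_mul,
    mul_assoc, mul_assoc, hT, mul_one]

/-- `(g₁ ▷ S(f(S(g₄), g₅))) f(g₂, S(g₃)) = ε(g)1`. -/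
lemma sum_act_antipode_mul (hact : IsWeakAction k A H act) (hc : CrossedConditions act f) (g : H) :
    ∑ i ∈ (ℛ k g).index, ∑ j ∈ (ℛ k ((ℛ k g).right i)).index,
      act ((ℛ k g).left i ⊗ₜ HopfAlgebra.antipode k
          (f (antipodeTmulId k H ((ℛ k ((ℛ k g).right i)).right j)))) *
        f (idTmulAntipode k H ((ℛ k ((ℛ k g).right i)).left j)) = counit (R := k) g • 1 := by
  have key := congrArg (fun X : Conv k (H ⊗[k] (H ⊗[k] H)) A => X (idTmulAntipodeTmulId k H g))
    (hc.actOn_antipode_comp_mul hact)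
  have h₁ (u : H ⊗[k] H) (w : H) : pre (assocC k H) (pre (fstC k (H ⊗[k] H) H)
      (toConv f : Conv k (H ⊗[k] H) A)) (TensorProduct.assoc k H H H (u ⊗ₜ w)) =
      counit (R := k) w • f u := by
    have : assocC k H (TensorProduct.assoc k H H H (u ⊗ₜ w)) = u ⊗ₜ w :=
      (TensorProduct.assoc k H H H).symm_apply_apply _
    simp [this]
  have h₂ (x z : H) : pre (idMulC k H) (toConv f : Conv k (H ⊗[k] H) A)
      (x ⊗ₜ antipodeTmulId k H z) = counit (R := k) x • counit (R := k) z • 1 := by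
    have : idMulC k H (x ⊗ₜ antipodeTmulId k H z) = counit (R := k) z • (x ⊗ₜ 1) := by
      rw [← TensorProduct.tmul_smul, ← mulCoalgHom_antipodeTmulId]
      rfl
    rw [pre_apply, this, map_smul, smul_comm]
    exact congrArg _ (f_one_right_iff.1 hc.f_one_right x)
  have h₃ (y w : H) : pre (assocC k H) (pre (mulIdC k H)
      (toConv (HopfAlgebra.antipode k ∘ₗ f) : Conv k (H ⊗[k] H) A))
      (TensorProduct.assoc k H H H (idTmulAntipode k H y ⊗ₜ w)) =
      counit (R := k) y • counit (R := k) w • 1 := by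
    have h : assocC k H (TensorProduct.assoc k H H H (idTmulAntipode k H y ⊗ₜ w)) =
      idTmulAntipode k H y ⊗ₜ w := (TensorProduct.assoc k H H H).symm_apply_apply _
    have : mulIdC k H (idTmulAntipode k H y ⊗ₜ w) = counit (R := k) y • (1 ⊗ₜ w) := by
      rw [TensorProduct.smul_tmul', ← mulCoalgHom_idTmulAntipode]
      rfl
    rw [pre_apply, pre_apply, h, this, map_smul]
    refine congrArg _ ?_
    change HopfAlgebra.antipode k (f (1 ⊗ₜ w)) = _
    rw [f_one_left_iff.1 hc.f_one_left, map_smul, HopfAlgebra.antipode_one]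
  have h₄ : ((1 : Conv k H A) * (1 * (1 * 1))) g = counit (R := k) g • 1 := by
    simp only [mul_one, one_apply]
  rw [← h₄]
  simp only [mul_idTmulAntipodeTmulId, h₁, h₂, h₃, actOn_apply] at key
  simp only [mul_apply_arbitrary, one_apply, Finset.mul_sum]
  refine Eq.trans (Finset.sum_congr rfl fun i _ => Finset.sum_congr rfl fun j _ => ?_)
    (key.trans (Finset.sum_congr rfl fun i _ => Finset.sum_congr rfl fun j _ => ?_))
  · conv_lhs => rw [← sum_counit_smul_right (ℛ k ((ℛ k ((ℛ k g).right i)).right j))]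
    simp [TensorProduct.tmul_sum, Finset.sum_mul]
  · refine Finset.sum_congr rfl fun l _ => ?_
    simp only [smul_smul, mul_one, mul_smul_comm]
    congr 1; ring

end CrossedConditions

end CocycleAntipode

section CrossedAntipode

open Coalgebra LinearMap WithConv Conv

variable {k : Type u} [CommRing k]
variable {C : Type u} [AddCommGroup C] [Module k C] [Coalgebra k C]
variable {A : Type u} [Ring A] [HopfAlgebra k A]
variable {H : Type u} [Ring H] [HopfAlgebra k H]
variable {act : H ⊗[k] A →ₗ[k] A} {f : H ⊗[k] H →ₗ[k] A}
  {mul : A ⊗[k] H →ₗ[k] A ⊗[k] H →ₗ[k] A ⊗[k] H}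

namespace Conv

variable {B V : Type u} [Ring B] [Algebra k B] [AddCommGroup V] [Module k V]

lemma map_mul_mul_apply (N : B →ₗ[k] V) (X Y Z : Conv k C B) (c : C) :
    N ((X * (Y * Z)) c) = ∑ i ∈ (ℛ k c).index, ∑ j ∈ (ℛ k ((ℛ k c).right i)).index,
      N (X ((ℛ k c).left i) * (Y ((ℛ k ((ℛ k c).right i)).left j) *
        Z ((ℛ k ((ℛ k c).right i)).right j))) := by
  simp only [mul_apply_arbitrary, Finset.mul_sum, map_sum]

lemma map_mul_mul_mul_apply (N : B →ₗ[k] V) (X Y Z W : Conv k C B) (c : C) :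
    N (((X * Y) * (Z * W)) c) = ∑ i ∈ (ℛ k c).index, ∑ j ∈ (ℛ k ((ℛ k c).right i)).index,
      ∑ l ∈ (ℛ k ((ℛ k c).left i)).index,
        N ((X ((ℛ k ((ℛ k c).left i)).left l) * Y ((ℛ k ((ℛ k c).left i)).right l)) *
          (Z ((ℛ k ((ℛ k c).right i)).left j) * W ((ℛ k ((ℛ k c).right i)).right j))) := by
  rw [mul_apply_arbitrary, map_sum]
  refine Finset.sum_congr rfl fun i _ => ?_
  rw [mul_apply_arbitrary Z, Finset.mul_sum, map_sum]
  simp only [mul_apply_arbitrary, Finset.sum_mul, map_sum]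

end Conv

variable (f) in
/-- The map `g ↦ S(f(S(g₂), g₃)) # S(g₁)`, the convolution inverse of `g ↦ 1 # g`. -/
noncomputable def antipodeIncl : Conv k H (A ⊗[k] H) :=
  post (inH k A H) (antipodeC k H) *
    post (inA k A H) (toConv (HopfAlgebra.antipode k ∘ₗ f ∘ₗ (antipodeTmulId k H).ofConv))

lemma antipodeIncl_apply (g : H) : antipodeIncl f g = ∑ i ∈ (ℛ k g).index,
    HopfAlgebra.antipode k (f (antipodeTmulId k H ((ℛ k g).right i))) ⊗ₜ
      HopfAlgebra.antipode k ((ℛ k g).left i) := by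
  rw [antipodeIncl, mul_apply_arbitrary]
  simp

lemma antipodeIncl_apply_of_repr {ι : Type*} [Fintype ι] {g : H} {g₁ g₂ g₃ : ι → H}
    (h : comul3 k H g = ∑ i, g₁ i ⊗ₜ[k] (g₂ i ⊗ₜ[k] g₃ i)) :
    antipodeIncl f g = ∑ i, HopfAlgebra.antipode k (f (HopfAlgebra.antipode k (g₂ i) ⊗ₜ g₃ i)) ⊗ₜ
      HopfAlgebra.antipode k (g₁ i) := by
  let E : Conv k H (H ⊗[k] (H ⊗[k] H)) := post (inA k H (H ⊗[k] H)) (antipodeC k H) *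
    post (inH k H (H ⊗[k] H)) (antipodeTmulId k H)
  let N : H ⊗[k] (H ⊗[k] H) →ₗ[k] A ⊗[k] H := (TensorProduct.comm k H A).toLinearMap ∘ₗ
    TensorProduct.map LinearMap.id (HopfAlgebra.antipode k ∘ₗ f)
  have h₁ : antipodeIncl f g = N (E g) := by
    rw [antipodeIncl_apply, mul_apply_arbitrary, map_sum]
    exact Finset.sum_congr rfl fun i _ => by simp [N]
  have h₂ : E g = ∑ i, HopfAlgebra.antipode k (g₁ i) ⊗ₜ[k]
      (HopfAlgebra.antipode k (g₂ i) ⊗ₜ[k] g₃ i) := by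
    simp only [E, antipodeTmulId, map_mul, mul_mul_apply_of_repr _ _ _ h]
    simp
  rw [h₁, h₂, map_sum]
  simp [N]

lemma cocycleMul_idTmulAntipode (g : H) :
    cocycleMul f (idTmulAntipode k H g) = inA k A H (f (idTmulAntipode k H g)) := by
  rw [cocycleMul, mul_idTmulAntipode]
  have h₁ (y : H) : post (inH k A H) (pre (Bialgebra.mulCoalgHom k H) (idC k H))
      (idTmulAntipode k H y) = counit (R := k) y • 1 := by
    rw [post_apply, pre_apply, mulCoalgHom_idTmulAntipode, idC_apply, map_smul, map_one]
  have h₂ : idTmulAntipode k H g = ∑ i ∈ (ℛ k g).index,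
      (ℛ k g).left i ⊗ₜ HopfAlgebra.antipode k ((ℛ k g).right i) := by
    rw [idTmulAntipode, mul_apply_arbitrary]
    simp
  rw [h₂, map_sum, map_sum]
  refine Finset.sum_congr rfl fun i _ => ?_
  conv_rhs => rw [← sum_counit_smul (ℛ k ((ℛ k g).right i))]
  simp only [h₁, map_sum, TensorProduct.tmul_sum, map_smul, TensorProduct.tmul_smul, mul_smul_comm,
    mul_one]
  rfl

lemma inA_antipode_mul_cocycleMul (hf : IsCoalgebraMap k f) (g : H) :
    (post (inA k A H) (toConv (HopfAlgebra.antipode k ∘ₗ f)) * cocycleMul f)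
      (antipodeTmulId k H g) = counit (R := k) g • 1 := by
  rw [cocycleMul, ← mul_assoc, ← map_mul, hf.antipode_comp_mul, map_one, one_mul, post_apply,
    pre_apply, mulCoalgHom_antipodeTmulId, idC_apply, map_smul, map_one]

namespace IsCrossedMul

lemma sum_antipodeIncl_mul (hm : IsCrossedMul act f mul) (hact : IsWeakAction k A H act)
    (hf : IsCoalgebraMap k f) (g : H) :
    ∑ i ∈ (ℛ k g).index, mul (antipodeIncl f ((ℛ k g).left i)) (1 ⊗ₜ (ℛ k g).right i) =
      counit (R := k) g • 1 := by
  rw [← inA_antipode_mul_cocycleMul hf, mul_antipodeTmulId]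
  simp only [antipodeIncl_apply, map_sum, LinearMap.sum_apply, hm.mul_one_tmul hact]
  rfl

lemma sum_mul_antipodeIncl (hm : IsCrossedMul act f mul) (hact : IsWeakAction k A H act)
    (hc : CrossedConditions act f) (g : H) :
    ∑ i ∈ (ℛ k g).index, mul (1 ⊗ₜ (ℛ k g).left i) (antipodeIncl f ((ℛ k g).right i)) =
      counit (R := k) g • 1 := by
  let e : H ⊗[k] H →ₐ[k] H ⊗[k] ((H ⊗[k] H) ⊗[k] H) :=
    (inH k H ((H ⊗[k] H) ⊗[k] H)).comp (inA k (H ⊗[k] H) H)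
  let P : Conv k H (H ⊗[k] ((H ⊗[k] H) ⊗[k] H)) := post (inA k H ((H ⊗[k] H) ⊗[k] H)) (idC k H)
  let K : Conv k H (H ⊗[k] ((H ⊗[k] H) ⊗[k] H)) :=
    post ((inH k H ((H ⊗[k] H) ⊗[k] H)).comp (inH k (H ⊗[k] H) H)) (idC k H)
  let α : H ⊗[k] H →ₗ[k] A :=
    act ∘ₗ TensorProduct.map LinearMap.id
      (HopfAlgebra.antipode k ∘ₗ f ∘ₗ (antipodeTmulId k H).ofConv)
  let N : H ⊗[k] ((H ⊗[k] H) ⊗[k] H) →ₗ[k] A ⊗[k] H :=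
    mul' k (A ⊗[k] H) ∘ₗ TensorProduct.map ((inA k A H).toLinearMap ∘ₗ α) (cocycleMul f).ofConv ∘ₗ
      (TensorProduct.assoc k H H (H ⊗[k] H)).symm.toLinearMap ∘ₗ
        TensorProduct.map LinearMap.id (TensorProduct.comm k (H ⊗[k] H) H).toLinearMap
  have hN (x : H) (u : H ⊗[k] H) (z : H) : N (x ⊗ₜ (u ⊗ₜ z)) =
      inA k A H (act (x ⊗ₜ HopfAlgebra.antipode k (f (antipodeTmulId k H z)))) *
        cocycleMul f u := rfl
  have key : (P * post (e.comp (inA k H H)) (idC k H)) *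
      (post (e.comp (inH k H H)) (antipodeC k H) * K) = P * (post e (idTmulAntipode k H) * K) := by
    rw [idTmulAntipode, map_mul, post_post, post_post]
    simp only [mul_assoc]
  have key₁ := map_mul_mul_mul_apply N P (post (e.comp (inA k H H)) (idC k H))
    (post (e.comp (inH k H H)) (antipodeC k H)) K g
  have key₂ := map_mul_mul_apply N P (post e (idTmulAntipode k H)) K g
  rw [← key] at key₂
  have key' := key₁.symm.trans key₂
  rw [← map_one (inA k A H), ← map_smul, ← hc.sum_act_antipode_mul hact]
  simp only [map_sum, map_mul, ← cocycleMul_idTmulAntipode]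
  refine Eq.trans ?_ (key'.trans ?_)
  · refine Finset.sum_congr rfl fun i _ => ?_
    rw [antipodeIncl_apply, map_sum]
    refine Finset.sum_congr rfl fun j _ => ?_
    rw [hm.one_tmul_mul, smashMul, pre_fstC_mul_tmul _ _ _ (ℛ k _)]
    refine Finset.sum_congr rfl fun l _ => ?_
    simp [P, K, e, hN]
  · exact Finset.sum_congr rfl fun i _ => Finset.sum_congr rfl fun j _ => by simp [P, K, e, hN]

end IsCrossedMul

end CrossedAntipode

section CrossedSystem

open Coalgebra LinearMap WithConv Conv

variable {k : Type u} [CommRing k]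
variable {A : Type u} [Ring A] [HopfAlgebra k A]
variable {H : Type u} [Ring H] [HopfAlgebra k H]
variable {act : H ⊗[k] A →ₗ[k] A} {f : H ⊗[k] H →ₗ[k] A}
  {mul : A ⊗[k] H →ₗ[k] A ⊗[k] H →ₗ[k] A ⊗[k] H}

variable (f mul) in
/-- The map `a # g ↦ (S(f(S(g₂), g₃)) # S(g₁)) · (S(a) # 1)`. -/
noncomputable def crossedAntipode : A ⊗[k] H →ₗ[k] A ⊗[k] H :=
  TensorProduct.lift ((mul.flip ∘ₗ (TensorProduct.mk k A H).flip 1 ∘ₗ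
    HopfAlgebra.antipode k).compl₂ (antipodeIncl f).ofConv)

@[simp] lemma crossedAntipode_tmul (a : A) (g : H) : crossedAntipode f mul (a ⊗ₜ g) =
    mul (antipodeIncl f g) (HopfAlgebra.antipode k a ⊗ₜ 1) := rfl

namespace IsCrossedMul

lemma tmul_one_mul (hm : IsCrossedMul act f mul) (hact : IsWeakAction k A H act)
    (hc : CrossedConditions act f) (a : A) (x : A ⊗[k] H) :
    mul (a ⊗ₜ 1) x = inA k A H a * x := by
  have := hm.inA_mul a (1 ⊗ₜ 1) x
  rwa [hm.one_mul hact hc.f_one_left, Algebra.TensorProduct.includeLeft_apply,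
    Algebra.TensorProduct.tmul_mul_tmul, _root_.mul_one, _root_.mul_one] at this

lemma lift_crossedAntipode_mul (hm : IsCrossedMul act f mul) (hact : IsWeakAction k A H act)
    (hc : CrossedConditions act f) (x : A ⊗[k] H) :
    TensorProduct.lift (mul ∘ₗ crossedAntipode f mul) (comul (R := k) x) =
      counit (R := k) x • 1 := by
  induction x with
  | zero => simp
  | add x y hx hy => rw [map_add, map_add, hx, hy, map_add, add_smul]
  | tmul a g =>
    have h (u v : H) : ∑ i ∈ (ℛ k a).index, mul (crossedAntipode f mul ((ℛ k a).left i ⊗ₜ u))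
        ((ℛ k a).right i ⊗ₜ v) = counit (R := k) a • mul (antipodeIncl f u) (1 ⊗ₜ v) := by
      simp only [crossedAntipode_tmul, hm.mul_assoc_of_conditions hact hc,
        hm.tmul_one_mul hact hc, Algebra.TensorProduct.includeLeft_apply,
        Algebra.TensorProduct.tmul_mul_tmul, _root_.one_mul]
      rw [← map_sum, ← TensorProduct.sum_tmul, HopfAlgebra.sum_antipode_mul_eq_smul,
        ← TensorProduct.smul_tmul', map_smul]
    rw [← (reprTmul (ℛ k a) (ℛ k g)).eq, map_sum]
    refine (Finset.sum_product_right _ _ _).trans ?_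
    simp only [reprTmul, TensorProduct.lift.tmul, LinearMap.comp_apply, h]
    rw [← Finset.smul_sum, hm.sum_antipodeIncl_mul hact hc.coalg_f, smul_smul]
    simp [mul_comm]

lemma lift_mul_crossedAntipode (hm : IsCrossedMul act f mul) (hact : IsWeakAction k A H act)
    (hc : CrossedConditions act f) (x : A ⊗[k] H) :
    TensorProduct.lift (mul.compl₂ (crossedAntipode f mul)) (comul (R := k) x) =
      counit (R := k) x • 1 := by
  induction x with
  | zero => simp
  | add x y hx hy => rw [map_add, map_add, hx, hy, map_add, add_smul]
  | tmul a g =>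
    have h (b c : A) : ∑ j ∈ (ℛ k g).index, mul (b ⊗ₜ (ℛ k g).left j)
        (crossedAntipode f mul (c ⊗ₜ (ℛ k g).right j)) =
          counit (R := k) g • ((b * HopfAlgebra.antipode k c) ⊗ₜ 1) := by
      have (u v : H) : mul (b ⊗ₜ u) (crossedAntipode f mul (c ⊗ₜ v)) =
          inA k A H b * mul (mul (1 ⊗ₜ u) (antipodeIncl f v)) (HopfAlgebra.antipode k c ⊗ₜ 1) := by
        rw [crossedAntipode_tmul, ← hm.mul_assoc_of_conditions hact hc, ← hm.inA_mul,
          ← hm.inA_mul]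
        simp
      simp only [this]
      rw [← Finset.mul_sum, ← LinearMap.sum_apply, ← map_sum, hm.sum_mul_antipodeIncl hact hc,
        map_smul, LinearMap.smul_apply, Algebra.TensorProduct.one_def,
        hm.one_mul hact hc.f_one_left, mul_smul_comm]
      simp
    rw [← (reprTmul (ℛ k a) (ℛ k g)).eq, map_sum]
    refine (Finset.sum_product _ _ _).trans ?_
    simp only [reprTmul, TensorProduct.lift.tmul, LinearMap.compl₂_apply, h]
    rw [← Finset.smul_sum, ← TensorProduct.sum_tmul, HopfAlgebra.sum_mul_antipode_eq_smul,
      ← TensorProduct.smul_tmul', smul_smul]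
    simp [Algebra.TensorProduct.one_def]

end IsCrossedMul

lemma CrossedConditions.isCrossedSystem (hact : IsWeakAction k A H act)
    (hc : CrossedConditions act f) : IsCrossedSystem k A H act f := by
  have hm := isCrossedMul_crossedMul act f
  exact ⟨
    { mul := crossedMul act f
      one := 1 ⊗ₜ 1
      mul_assoc := hm.mul_assoc_of_conditions hact hc
      one_mul := hm.one_mul hact hc.f_one_left
      mul_one := hm.mul_one hact hc.f_one_right
      counit_one := by simp
      counit_mul := hm.counit_mul hc
      comul_one := by simp [Algebra.TensorProduct.one_def]
      comul_mul := fun x y n m x₁ x₂ y₁ y₂ hx hy => by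
        rw [hm.comul_mul hc, hx, hy, Finset.sum_comm]
        simp
      antipode := crossedAntipode f (crossedMul act f)
      antipode_mul_id := fun x n x₁ x₂ hx => by
        rw [← Algebra.TensorProduct.one_def, ← hm.lift_crossedAntipode_mul hact hc, hx]
        simp
      id_mul_antipode := fun x n x₁ x₂ hx => by
        rw [← Algebra.TensorProduct.one_def, ← hm.lift_mul_crossedAntipode hact hc, hx]
        simp }, rfl, (crossedProductMul_iff act f _).2 hm⟩

/-- A left convolution inverse of the identity is the antipode. -/
lemma HopfAlgebraOn.antipode_eq {V : Type u} [AddCommGroup V] [Module k V] [Coalgebra k V]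
    (hs : HopfAlgebraOn k V) (S : V →ₗ[k] V)
    (hS : ∀ x, TensorProduct.lift (hs.mul ∘ₗ S) (comul (R := k) x) = counit (R := k) x • hs.one) :
    hs.antipode = S := by
  have h₁ (x : V) : ∑ i ∈ (ℛ k x).index, hs.mul (S ((ℛ k x).left i)) ((ℛ k x).right i) =
      counit (R := k) x • hs.one := by
    rw [← hS]
    conv_rhs => rw [← (ℛ k x).eq]
    simp
  have h₂ (x : V) : TensorProduct.lift (hs.mul.compl₂ hs.antipode) (comul (R := k) x) =
      counit (R := k) x • hs.one := by
    obtain ⟨n, x₁, x₂, hx⟩ := TensorProduct.exists_fin_sum (comul (R := k) x)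
    rw [← hs.id_mul_antipode x n x₁ x₂ hx, hx]
    simp
  have h₃ (x : V) : ∑ i ∈ (ℛ k x).index, hs.mul ((ℛ k x).left i) (hs.antipode ((ℛ k x).right i)) =
      counit (R := k) x • hs.one := by
    rw [← h₂]
    conv_rhs => rw [← (ℛ k x).eq]
    simp
  ext x
  let N : V ⊗[k] (V ⊗[k] V) →ₗ[k] V :=
    TensorProduct.lift (hs.mul ∘ₗ S) ∘ₗ
      TensorProduct.map LinearMap.id (TensorProduct.lift (hs.mul.compl₂ hs.antipode))
  have key := congrArg N (sum_tmul_tmul_eq (ℛ k x) (fun i => ℛ k ((ℛ k x).left i))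
    (fun i => ℛ k ((ℛ k x).right i)))
  simp only [N, map_sum, LinearMap.comp_apply, TensorProduct.map_tmul, TensorProduct.lift.tmul,
    LinearMap.compl₂_apply, LinearMap.id_apply] at key
  have hl (i) : ∑ j ∈ (ℛ k ((ℛ k x).left i)).index,
      hs.mul (S ((ℛ k ((ℛ k x).left i)).left j)) (hs.mul ((ℛ k ((ℛ k x).left i)).right j)
        (hs.antipode ((ℛ k x).right i))) =
      hs.antipode (counit (R := k) ((ℛ k x).left i) • (ℛ k x).right i) := by
    simp only [← hs.mul_assoc]
    rw [← LinearMap.sum_apply, ← map_sum, h₁, map_smul, LinearMap.smul_apply, hs.one_mul, map_smul]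
  have hr (i) : ∑ j ∈ (ℛ k ((ℛ k x).right i)).index,
      hs.mul (S ((ℛ k x).left i)) (hs.mul ((ℛ k ((ℛ k x).right i)).left j)
        (hs.antipode ((ℛ k ((ℛ k x).right i)).right j))) =
      S (counit (R := k) ((ℛ k x).right i) • (ℛ k x).left i) := by
    rw [← map_sum, h₃, map_smul, hs.mul_one, map_smul]
  simp only [hl, hr] at key
  rwa [← map_sum, ← map_sum, sum_counit_smul, sum_counit_smul_right] at key

lemma CrossedConditions.antipode_eq (hact : IsWeakAction k A H act)
    (hc : CrossedConditions act f) (hs : HopfAlgebraOn k (A ⊗[k] H)) (h1 : hs.one = 1 ⊗ₜ 1)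
    (hm : IsCrossedMul act f hs.mul) : hs.antipode = crossedAntipode f hs.mul :=
  hs.antipode_eq _ fun x => by rw [hm.lift_crossedAntipode_mul hact hc, h1,
    Algebra.TensorProduct.one_def]

lemma crossedConditions_iff : CrossedConditions act f ↔ IsCoalgebraMap k act ∧
    IsCoalgebraMap k f ∧
    (pre (inlC k H H) (toConv f : Conv k (H ⊗[k] H) A) = 1 ∧
      pre (inrC k H H) (toConv f : Conv k (H ⊗[k] H) A) = 1) ∧
    (∀ a, actOn act (actAt act a) * (toConv f : Conv k (H ⊗[k] H) A) =
      toConv f * pre (Bialgebra.mulCoalgHom k H) (actAt act a)) ∧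
    actOn act (toConv f) * pre (idMulC k H) (toConv f : Conv k (H ⊗[k] H) A) =
      pre (assocC k H) (pre (fstC k (H ⊗[k] H) H) (toConv f) * pre (mulIdC k H) (toConv f)) ∧
    (∀ a, Commute (post (inH k A H) (idC k H)) (post (inA k A H) (actAt act a))) ∧
    Commute (post (inH k A H) (pre (Bialgebra.mulCoalgHom k H) (idC k H)))
      (post (inA k A H) (toConv f)) :=
  ⟨fun h => ⟨h.1, h.2, ⟨h.3, h.4⟩, h.5, h.6, h.7, h.8⟩,
    fun ⟨h₁, h₂, ⟨h₃, h₄⟩, h₅, h₆, h₇, h₈⟩ => ⟨h₁, h₂, h₃, h₄, h₅, h₆, h₇, h₈⟩⟩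

lemma isCrossedSystem_iff (hact : IsWeakAction k A H act) :
    IsCrossedSystem k A H act f ↔ CrossedConditions act f :=
  ⟨fun ⟨hs, h1, hm⟩ => .of_hopfAlgebraOn hact hs h1 hm, fun hc => hc.isCrossedSystem hact⟩

end CrossedSystem

/-!
STATEMENT 0: Characterization of when `A #_f^▷ H` is a crossed product of Hopf algebras,
together with the formula for its antipode.
-/

theorem crossed_product_iff (k : Type u) [Field k]
    (A : Type u) [Ring A] [HopfAlgebra k A] (H : Type u) [Ring H] [HopfAlgebra k H]
    (act : H ⊗[k] A →ₗ[k] A) (f : H ⊗[k] H →ₗ[k] A)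
    (hact : IsWeakAction k A H act) :
    (IsCrossedSystem k A H act f ↔
      (IsCoalgebraMap k act ∧ IsCoalgebraMap k f ∧
      -- (i) normalization
      (∀ h : H, f (h ⊗ₜ[k] (1 : H)) = Coalgebra.counit (R := k) h • (1 : A) ∧
        f ((1 : H) ⊗ₜ[k] h) = Coalgebra.counit (R := k) h • (1 : A)) ∧
      -- (ii) twisted module condition
      (∀ (a : A) (g h : H) (n m : ℕ) (g₁ g₂ : Fin n → H) (h₁ h₂ : Fin m → H),
        Coalgebra.comul (R := k) g = ∑ i, g₁ i ⊗ₜ[k] g₂ i →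
        Coalgebra.comul (R := k) h = ∑ j, h₁ j ⊗ₜ[k] h₂ j →
        ∑ i, ∑ j, act (g₁ i ⊗ₜ[k] act (h₁ j ⊗ₜ[k] a)) * f (g₂ i ⊗ₜ[k] h₂ j) =
          ∑ i, ∑ j, f (g₁ i ⊗ₜ[k] h₁ j) * act ((g₂ i * h₂ j) ⊗ₜ[k] a)) ∧
      -- (iii) cocycle condition
      (∀ (g h l : H) (n m r : ℕ) (g₁ g₂ : Fin n → H) (h₁ h₂ : Fin m → H)
        (l₁ l₂ : Fin r → H),
        Coalgebra.comul (R := k) g = ∑ i, g₁ i ⊗ₜ[k] g₂ i →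
        Coalgebra.comul (R := k) h = ∑ j, h₁ j ⊗ₜ[k] h₂ j →
        Coalgebra.comul (R := k) l = ∑ s, l₁ s ⊗ₜ[k] l₂ s →
        ∑ i, ∑ j, ∑ s, act (g₁ i ⊗ₜ[k] f (h₁ j ⊗ₜ[k] l₁ s)) *
            f (g₂ i ⊗ₜ[k] (h₂ j * l₂ s)) =
          ∑ i, ∑ j, f (g₁ i ⊗ₜ[k] h₁ j) * f ((g₂ i * h₂ j) ⊗ₜ[k] l)) ∧
      -- (iv) symmetry of the action
      (∀ (a : A) (g : H) (n : ℕ) (g₁ g₂ : Fin n → H),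
        Coalgebra.comul (R := k) g = ∑ i, g₁ i ⊗ₜ[k] g₂ i →
        ∑ i, g₁ i ⊗ₜ[k] act (g₂ i ⊗ₜ[k] a) = ∑ i, g₂ i ⊗ₜ[k] act (g₁ i ⊗ₜ[k] a)) ∧
      -- (v) symmetry of the cocycle
      (∀ (g h : H) (n m : ℕ) (g₁ g₂ : Fin n → H) (h₁ h₂ : Fin m → H),
        Coalgebra.comul (R := k) g = ∑ i, g₁ i ⊗ₜ[k] g₂ i →
        Coalgebra.comul (R := k) h = ∑ j, h₁ j ⊗ₜ[k] h₂ j →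
        ∑ i, ∑ j, (g₁ i * h₁ j) ⊗ₜ[k] f (g₂ i ⊗ₜ[k] h₂ j) =
          ∑ i, ∑ j, (g₂ i * h₂ j) ⊗ₜ[k] f (g₁ i ⊗ₜ[k] h₁ j)))) ∧
    -- the antipode formula
    (∀ hs : HopfAlgebraOn k (A ⊗[k] H),
      hs.one = (1 : A) ⊗ₜ[k] (1 : H) → CrossedProductMul k A H hs act f →
      ∀ (a : A) (g : H) (n : ℕ) (g₁ g₂ g₃ : Fin n → H),
        comul3 k H g = ∑ i, g₁ i ⊗ₜ[k] (g₂ i ⊗ₜ[k] g₃ i) →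
        hs.antipode (a ⊗ₜ[k] g) =
          ∑ i, hs.mul
            ((HopfAlgebra.antipode (R := k)
                (f (HopfAlgebra.antipode (R := k) (g₂ i) ⊗ₜ[k] g₃ i))) ⊗ₜ[k]
              HopfAlgebra.antipode (R := k) (g₁ i))
            (HopfAlgebra.antipode (R := k) a ⊗ₜ[k] (1 : H))) := by
  refine ⟨?_, fun hs h1 hm a g n g₁ g₂ g₃ hg => ?_⟩
  · rw [isCrossedSystem_iff hact, crossedConditions_iff, f_one_right_iff, f_one_left_iff,
      cocycle_iff, f_comm_iff, ← forall_and]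
    simp only [twisted_iff, act_comm_iff]
  · have hc := CrossedConditions.of_hopfAlgebraOn hact hs h1 hm
    rw [hc.antipode_eq hact hs h1 ((crossedProductMul_iff act f hs).1 hm), crossedAntipode_tmul,
      antipodeIncl_apply_of_repr hg, map_sum, LinearMap.sum_apply]
end

section
/- Let A and H be Hopf algebras over a field k. Then any coalgebra split extension (E, π) of A by H is equivalent to a crossed product extension (A #_f^▷ H, π_H) of A by H for some crossed system of Hopf algebras (A, H, ▷, f), where π_H : A #_f^▷ H → H is given by π_H(a # h) = ε_A(a)h. -/
open TensorProduct BigOperators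

universe u

section SplitExt

variable (k : Type u) [CommRing k]
variable (A : Type u) [Ring A] [HopfAlgebra k A]
variable (E : Type u) [Ring E] [HopfAlgebra k E]
variable (H : Type u) [Ring H] [HopfAlgebra k H]

/-- A coalgebra split extension of `A` by `H`: a Hopf algebra `E` fitting into
`A ↪ E →^π H` where `π` is a Hopf algebra map admitting a coalgebra section and
`A ≅ E^{co(H)}`. -/
structure CoalgebraSplitExtension where
  i : A →ₐc[k] E
  π : E →ₐc[k] H
  i_injective : Function.Injective i
  sec : H →ₗc[k] E
  π_sec : ∀ h : H, π (sec h) = h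
  range_i : Set.range i =
    {z : E | (TensorProduct.map LinearMap.id π.toLinearMap)
        (Coalgebra.comul (R := k) z) = z ⊗ₜ[k] (1 : H)}

end SplitExt

/-!
STATEMENT 1: any coalgebra split extension `(E, π)` of `A` by `H` is equivalent to a
crossed product extension `(A #_f^▷ H, π_H)`, i.e. there is a Hopf algebra isomorphism
`ψ : E → A #_f^▷ H` stabilizing `A` and co-stabilizing `H`.
-/

section
variable {k : Type u} [CommRing k] {A E H : Type u} [Ring A] [HopfAlgebra k A]
  [Ring E] [HopfAlgebra k E] [Ring H] [HopfAlgebra k H]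

open WithConv HopfAlgebra

/-- The right coaction `x ↦ x₁ ⊗ p(x₂)` of `H` on `E`. -/
noncomputable def coaction (p : E →ₐc[k] H) : E →ₐ[k] E ⊗[k] H :=
  (Algebra.TensorProduct.map (.id k E) (p : E →ₐ[k] H)).comp (Bialgebra.comulAlgHom k E)

theorem coaction_apply (p : E →ₐc[k] H) (x : E) :
    coaction p x = TensorProduct.map LinearMap.id p.toLinearMap (Coalgebra.comul (R := k) x) :=
  rfl

theorem map_coaction {M N : Type u} [AddCommGroup M] [Module k M] [AddCommGroup N] [Module k N]
    (p : E →ₐc[k] H) (f : E →ₗ[k] M) (g : H →ₗ[k] N) (x : E) :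
    TensorProduct.map f g (coaction p x) =
      TensorProduct.map f (g ∘ₗ p.toLinearMap) (Coalgebra.comul (R := k) x) := by
  rw [coaction_apply, ← LinearMap.comp_apply, ← TensorProduct.map_comp, LinearMap.comp_id]

theorem coaction_section (p : E →ₐc[k] H) (s : H →ₗc[k] E) (hs : ∀ h, p (s h) = h) (h : H) :
    coaction p (s h) = TensorProduct.map s.toLinearMap LinearMap.id (Coalgebra.comul (R := k) h) := by
  have hps : p.toLinearMap ∘ₗ s.toLinearMap = LinearMap.id := LinearMap.ext hs
  have hc : Coalgebra.comul (R := k) (s h) =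
      TensorProduct.map s.toLinearMap s.toLinearMap (Coalgebra.comul (R := k) h) :=
    (CoalgHomClass.map_comp_comul_apply s h).symm
  rw [coaction_apply, hc, ← LinearMap.comp_apply, ← TensorProduct.map_comp, hps, LinearMap.id_comp]

section
variable {C : Type u} [AddCommGroup C] [Module k C] [Coalgebra k C]

theorem convOne_comp_coalgHom (g : C →ₗc[k] E) :
    (1 : WithConv (E →ₗ[k] E)).ofConv ∘ₗ g.toLinearMap = (1 : WithConv (C →ₗ[k] E)).ofConv := by
  ext x
  exact congrArg (algebraMap k E) (CoalgHomClass.counit_comp_apply g x)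

theorem antipode_comp_conv_self (g : C →ₗc[k] E) :
    toConv (antipode k ∘ₗ g.toLinearMap) * toConv g.toLinearMap = 1 := by
  have h := LinearMap.convMul_comp_coalgHom_distrib (toConv (antipode k (A := E)))
    (toConv LinearMap.id) g
  rw [LinearMap.antipode_mul_id, convOne_comp_coalgHom] at h
  exact WithConv.ext h.symm

theorem self_conv_antipode_comp (g : C →ₗc[k] E) :
    toConv g.toLinearMap * toConv (antipode k ∘ₗ g.toLinearMap) = 1 := by
  have h := LinearMap.convMul_comp_coalgHom_distrib (toConv LinearMap.id)
    (toConv (antipode k (A := E))) g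
  rw [LinearMap.id_mul_antipode, convOne_comp_coalgHom] at h
  exact WithConv.ext h.symm

theorem algHom_conv_mul {B D : Type u} [Ring B] [Algebra k B] [Ring D] [Algebra k D]
    (r : B →ₐ[k] D) (f g : C →ₗ[k] B) :
    toConv (r.toLinearMap ∘ₗ (toConv f * toConv g).ofConv) =
      toConv (r.toLinearMap ∘ₗ f) * toConv (r.toLinearMap ∘ₗ g) :=
  WithConv.ext (LinearMap.algHom_comp_convMul_distrib r (toConv f) (toConv g))

theorem algHom_conv_eq_one {B D : Type u} [Ring B] [Algebra k B] [Ring D] [Algebra k D]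
    (r : B →ₐ[k] D) {f g : C →ₗ[k] B} (h : toConv f * toConv g = 1) :
    toConv (r.toLinearMap ∘ₗ f) * toConv (r.toLinearMap ∘ₗ g) = 1 := by
  rw [← algHom_conv_mul, h]
  apply WithConv.ext
  ext x
  exact r.commutes _
end

/-- The projection `x ↦ x₁ S(s(p(x₂)))` of `E` onto the coinvariants. -/
noncomputable def retraction (p : E →ₐc[k] H) (s : H →ₗc[k] E) : E →ₗ[k] E :=
  LinearMap.mul' k E ∘ₗ TensorProduct.map LinearMap.id (antipode k ∘ₗ s.toLinearMap) ∘ₗ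
    (coaction p).toLinearMap

theorem retraction_apply (p : E →ₐc[k] H) (s : H →ₗc[k] E) (x : E) :
    retraction p s x = LinearMap.mul' k E
      (TensorProduct.map LinearMap.id (antipode k ∘ₗ s.toLinearMap) (coaction p x)) := rfl

theorem toConv_retraction (p : E →ₐc[k] H) (s : H →ₗc[k] E) :
    toConv (retraction p s) = toConv LinearMap.id *
      toConv (antipode k ∘ₗ (s.comp p.toCoalgHom).toLinearMap) := by
  apply WithConv.ext
  ext x
  exact congrArg _ (map_coaction p _ _ x)

theorem retraction_conv (p : E →ₐc[k] H) (s : H →ₗc[k] E) :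
    toConv (retraction p s) * toConv (s.comp p.toCoalgHom).toLinearMap = toConv LinearMap.id := by
  rw [toConv_retraction, mul_assoc, antipode_comp_conv_self, mul_one]

theorem mul_map_retraction_coaction (p : E →ₐc[k] H) (s : H →ₗc[k] E) (x : E) :
    LinearMap.mul' k E (TensorProduct.map (retraction p s) s.toLinearMap (coaction p x)) = x := by
  rw [map_coaction]
  exact congr($(retraction_conv p s).ofConv x)

theorem mul_map_include {M : Type u} [AddCommGroup M] [Module k M] {N : Type u} [AddCommGroup N]
    [Module k N] (f : M →ₗ[k] E) (g : N →ₗ[k] H) (t : M ⊗[k] N) :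
    LinearMap.mul' k (E ⊗[k] H) (TensorProduct.map
      ((Algebra.TensorProduct.includeLeft : E →ₐ[k] E ⊗[k] H).toLinearMap ∘ₗ f)
      ((Algebra.TensorProduct.includeRight : H →ₐ[k] E ⊗[k] H).toLinearMap ∘ₗ g) t) =
    TensorProduct.map f g t := by
  induction t with
  | zero => simp
  | tmul x y => simp
  | add x y hx hy => simp only [map_add, hx, hy]

theorem coaction_comp_section (p : E →ₐc[k] H) (s : H →ₗc[k] E) (hs : ∀ h, p (s h) = h) :
    toConv ((coaction p).toLinearMap ∘ₗ (s.comp p.toCoalgHom).toLinearMap) =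
      toConv ((Algebra.TensorProduct.includeLeft : E →ₐ[k] E ⊗[k] H).toLinearMap ∘ₗ
        (s.comp p.toCoalgHom).toLinearMap) *
      toConv ((Algebra.TensorProduct.includeRight : H →ₐ[k] E ⊗[k] H).toLinearMap ∘ₗ
        p.toLinearMap) := by
  apply WithConv.ext
  ext x
  have hc : Coalgebra.comul (R := k) (p x) =
      TensorProduct.map p.toLinearMap p.toLinearMap (Coalgebra.comul (R := k) x) :=
    (CoalgHomClass.map_comp_comul_apply p x).symm
  refine Eq.trans ?_ (mul_map_include _ _ _).symm
  refine (coaction_section p s hs (p x)).trans ?_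
  rw [hc, ← LinearMap.comp_apply, ← TensorProduct.map_comp]
  rfl

theorem coaction_eq_conv (p : E →ₐc[k] H) :
    toConv (coaction p).toLinearMap =
      toConv ((Algebra.TensorProduct.includeLeft : E →ₐ[k] E ⊗[k] H).toLinearMap ∘ₗ LinearMap.id) *
      toConv ((Algebra.TensorProduct.includeRight : H →ₐ[k] E ⊗[k] H).toLinearMap ∘ₗ
        p.toLinearMap) := by
  apply WithConv.ext
  ext x
  exact (mul_map_include _ _ _).symm

theorem coaction_retraction (p : E →ₐc[k] H) (s : H →ₗc[k] E) (hs : ∀ h, p (s h) = h) (x : E) :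
    coaction p (retraction p s x) = retraction p s x ⊗ₜ[k] 1 := by
  set j : E →ₐ[k] E ⊗[k] H := Algebra.TensorProduct.includeLeft
  set g := s.comp p.toCoalgHom
  suffices h : toConv ((coaction p).toLinearMap ∘ₗ retraction p s) =
      toConv (j.toLinearMap ∘ₗ retraction p s) from congr(($h).ofConv x)
  have e : retraction p s = (toConv LinearMap.id * toConv (antipode k ∘ₗ g.toLinearMap)).ofConv :=
    congrArg WithConv.ofConv (toConv_retraction p s)
  have hρ := algHom_conv_eq_one (coaction p) (self_conv_antipode_comp g)
  have hj := algHom_conv_eq_one j (antipode_comp_conv_self g)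
  rw [e, algHom_conv_mul, algHom_conv_mul, LinearMap.comp_id, coaction_eq_conv]
  rw [coaction_comp_section p s hs] at hρ
  rw [mul_assoc]
  congr 1
  calc
    _ = (toConv (j.toLinearMap ∘ₗ antipode k ∘ₗ g.toLinearMap) *
        toConv (j.toLinearMap ∘ₗ g.toLinearMap)) * _ := by rw [hj, one_mul]
    _ = _ := by rw [mul_assoc, ← mul_assoc (toConv (j.toLinearMap ∘ₗ g.toLinearMap)), hρ, mul_one]

theorem mul_section_conv_antipode (s : H →ₗc[k] E) (h : H) :
    LinearMap.mul' k E (TensorProduct.map s.toLinearMap (antipode k ∘ₗ s.toLinearMap)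
      (Coalgebra.comul (R := k) h)) = algebraMap k E (Coalgebra.counit (R := k) h) :=
  congr(($(self_conv_antipode_comp s)).ofConv h)

theorem retraction_mul_section (p : E →ₐc[k] H) (s : H →ₗc[k] E) (hs : ∀ h, p (s h) = h)
    {b : E} (hb : coaction p b = b ⊗ₜ[k] 1) (h : H) :
    retraction p s (b * s h) = Coalgebra.counit (R := k) h • b := by
  have key (t : H ⊗[k] H) :
      LinearMap.mul' k E (TensorProduct.map LinearMap.id (antipode k ∘ₗ s.toLinearMap)
        (b ⊗ₜ[k] 1 * TensorProduct.map s.toLinearMap LinearMap.id t)) =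
      b * LinearMap.mul' k E
        (TensorProduct.map s.toLinearMap (antipode k ∘ₗ s.toLinearMap) t) := by
    induction t with
    | zero => simp
    | tmul x y => simp [mul_assoc]
    | add x y hx hy => simp only [map_add, mul_add, hx, hy]
  rw [retraction_apply, map_mul, hb, coaction_section p s hs, key, mul_section_conv_antipode,
    ← Algebra.commutes, ← Algebra.smul_def]

theorem map_coaction_mul_section {M : Type u} [AddCommGroup M] [Module k M] (p : E →ₐc[k] H)
    (s : H →ₗc[k] E) (hs : ∀ h, p (s h) = h) {b : E} (hb : coaction p b = b ⊗ₜ[k] 1)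
    (r : E →ₗ[k] M) (a : M) (hr : ∀ h, r (b * s h) = Coalgebra.counit (R := k) h • a) (h : H) :
    TensorProduct.map r LinearMap.id (coaction p (b * s h)) = a ⊗ₜ[k] h := by
  have key (t : H ⊗[k] H) :
      TensorProduct.map r LinearMap.id
        (b ⊗ₜ[k] 1 * TensorProduct.map s.toLinearMap LinearMap.id t) =
      TensorProduct.map (LinearMap.toSpanSingleton k M a) LinearMap.id
        ((Coalgebra.counit (R := k)).rTensor H t) := by
    induction t with
    | zero => simp
    | tmul x y => simp [hr]
    | add x y hx hy => simp only [map_add, mul_add, hx, hy]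
  rw [map_mul, hb, coaction_section p s hs, key, Coalgebra.rTensor_counit_comul]
  simp

/-- `s(h) b = T(s(h₁) b) s(h₂)` for coinvariant `b`, where `T` is `retraction p s`. -/
theorem mul_retraction_section_mul_coinvariant (p : E →ₐc[k] H) (s : H →ₗc[k] E)
    (hs : ∀ h, p (s h) = h) {b : E} (hb : coaction p b = b ⊗ₜ[k] 1) (h : H) :
    LinearMap.mul' k E (TensorProduct.map (retraction p s ∘ₗ LinearMap.mulRight k b ∘ₗ s.toLinearMap)
      s.toLinearMap (Coalgebra.comul (R := k) h)) = s h * b := by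
  have key (t : H ⊗[k] H) :
      TensorProduct.map (retraction p s ∘ₗ LinearMap.mulRight k b ∘ₗ s.toLinearMap)
        s.toLinearMap t =
      TensorProduct.map (retraction p s) s.toLinearMap
        (TensorProduct.map s.toLinearMap LinearMap.id t * b ⊗ₜ[k] 1) := by
    induction t with
    | zero => simp
    | tmul x y => simp
    | add x y hx hy => simp only [map_add, add_mul, hx, hy]
  rw [key, ← hb, ← coaction_section p s hs, ← map_mul, mul_map_retraction_coaction]

/-- `s(h) s(g) = T(s(h₁) s(g₁)) s(h₂ g₂)`, where `T` is `retraction p s`. -/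
theorem sum_retraction_mul_section {m : ℕ} (p : E →ₐc[k] H) (s : H →ₗc[k] E)
    (hs : ∀ h, p (s h) = h) (h g : H) (g₁ g₂ : Fin m → H)
    (hg : Coalgebra.comul (R := k) g = ∑ j, g₁ j ⊗ₜ[k] g₂ j) :
    LinearMap.mul' k E (∑ j, TensorProduct.map
      (retraction p s ∘ₗ LinearMap.mulRight k (s (g₁ j)) ∘ₗ s.toLinearMap)
      (s.toLinearMap ∘ₗ LinearMap.mulRight k (g₂ j)) (Coalgebra.comul (R := k) h)) = s h * s g := by
  have key (t : H ⊗[k] H) :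
      ∑ j, TensorProduct.map (retraction p s ∘ₗ LinearMap.mulRight k (s (g₁ j)) ∘ₗ s.toLinearMap)
        (s.toLinearMap ∘ₗ LinearMap.mulRight k (g₂ j)) t =
      TensorProduct.map (retraction p s) s.toLinearMap
        (TensorProduct.map s.toLinearMap LinearMap.id t *
          ∑ j, s (g₁ j) ⊗ₜ[k] g₂ j) := by
    induction t with
    | zero => simp
    | tmul x y => simp [Finset.mul_sum]
    | add x y hx hy => simp only [map_add, add_mul, Finset.sum_add_distrib, hx, hy]
  have hg' : coaction p (s g) = ∑ j, s (g₁ j) ⊗ₜ[k] g₂ j := by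
    rw [coaction_section p s hs, hg]; simp
  rw [key, ← hg', ← coaction_section p s hs, ← map_mul, mul_map_retraction_coaction]

theorem section_mul_mul_section {n m : ℕ} (p : E →ₐc[k] H) (s : H →ₗc[k] E)
    (hs : ∀ h, p (s h) = h) {b : E} (hb : coaction p b = b ⊗ₜ[k] 1) (h g : H)
    (h₁ h₂ h₃ : Fin n → H) (g₁ g₂ : Fin m → H)
    (hh : TensorProduct.map LinearMap.id (Coalgebra.comul (R := k)) (Coalgebra.comul (R := k) h) =
      ∑ i, h₁ i ⊗ₜ[k] (h₂ i ⊗ₜ[k] h₃ i))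
    (hg : Coalgebra.comul (R := k) g = ∑ j, g₁ j ⊗ₜ[k] g₂ j) :
    ∑ i, ∑ j, retraction p s (s (h₁ i) * b) * retraction p s (s (h₂ i) * s (g₁ j)) *
      s (h₃ i * g₂ j) = s h * b * s g := by
  set Ψ : H ⊗[k] H →ₗ[k] E := LinearMap.mul' k E ∘ₗ ∑ j, TensorProduct.map
      (retraction p s ∘ₗ LinearMap.mulRight k (s (g₁ j)) ∘ₗ s.toLinearMap)
      (s.toLinearMap ∘ₗ LinearMap.mulRight k (g₂ j)) with hΨ
  have hΨΔ : Ψ ∘ₗ Coalgebra.comul = LinearMap.mulRight k (s g) ∘ₗ s.toLinearMap := by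
    ext x
    simpa [hΨ] using sum_retraction_mul_section p s hs x g g₁ g₂ hg
  set T := retraction p s ∘ₗ LinearMap.mulRight k b ∘ₗ s.toLinearMap with hT
  have key := congrArg (fun t => LinearMap.mul' k E (TensorProduct.map T Ψ t)) hh
  beta_reduce at key
  rw [← LinearMap.comp_apply (TensorProduct.map _ _), ← TensorProduct.map_comp, hΨΔ,
    LinearMap.comp_id] at key
  have hmul (t : H ⊗[k] H) : LinearMap.mul' k E (TensorProduct.map T
      (LinearMap.mulRight k (s g) ∘ₗ s.toLinearMap) t) =
      LinearMap.mul' k E (TensorProduct.map T s.toLinearMap t) * s g := by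
    induction t with
    | zero => simp
    | tmul x y => simp [mul_assoc]
    | add x y hx hy => simp only [map_add, add_mul, hx, hy]
  rw [hmul, mul_retraction_section_mul_coinvariant p s hs hb] at key
  rw [key]
  simp [hΨ, hT, Finset.mul_sum, mul_assoc]

theorem exists_normalized_section (p : E →ₐc[k] H) (s : H →ₗc[k] E) (hs : ∀ h, p (s h) = h) :
    ∃ s' : H →ₗc[k] E, (∀ h, p (s' h) = h) ∧ s' 1 = 1 := by
  have h1 : IsGroupLikeElem k (s 1) :=
    IsGroupLikeElem.map s ⟨Bialgebra.counit_one, Bialgebra.comul_one⟩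
  have hu : IsGroupLikeElem k (antipode k (s 1)) := h1.antipode
  refine ⟨⟨LinearMap.mulLeft k (antipode k (s 1)) ∘ₗ s.toLinearMap, ?_, ?_⟩, ?_, ?_⟩
  · ext x
    simp [hu.counit_eq_one]
  · ext x
    have key (t : H ⊗[k] H) : TensorProduct.map
        (LinearMap.mulLeft k (antipode k (s 1)) ∘ₗ s.toLinearMap)
        (LinearMap.mulLeft k (antipode k (s 1)) ∘ₗ s.toLinearMap) t =
        antipode k (s 1) ⊗ₜ[k] antipode k (s 1) *
          TensorProduct.map s.toLinearMap s.toLinearMap t := by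
      induction t with
      | zero => simp
      | tmul x y => simp
      | add x y hx hy => simp only [map_add, mul_add, hx, hy]
    have hc : Coalgebra.comul (R := k) (s x) =
        TensorProduct.map s.toLinearMap s.toLinearMap (Coalgebra.comul (R := k) x) :=
      (CoalgHomClass.map_comp_comul_apply s x).symm
    refine (key _).trans ?_
    rw [← hc, ← hu.comul_eq_tmul_self]
    exact (Bialgebra.comul_mul _ _).symm
  · intro h
    have hp : p (antipode k (s 1)) = 1 := by
      have := congrArg p h1.antipode_mul_cancel
      rwa [map_mul, hs, mul_one, map_one p] at this
    change p (antipode k (s 1) * s h) = h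
    rw [map_mul, hp, hs, one_mul]
  · exact h1.antipode_mul_cancel

theorem map_eq_counit_smul_of_coaction (p : E →ₐc[k] H) {b : E}
    (hb : coaction p b = b ⊗ₜ[k] 1) : p b = Coalgebra.counit (R := k) b • 1 := by
  have h := congrArg (fun t => TensorProduct.lid k H
    (TensorProduct.map (Coalgebra.counit (R := k)) LinearMap.id t)) hb
  beta_reduce at h
  rw [map_coaction] at h
  have key (t : E ⊗[k] E) : TensorProduct.lid k H (TensorProduct.map (Coalgebra.counit (R := k))
      (LinearMap.id ∘ₗ p.toLinearMap) t) =
      p (TensorProduct.lid k E ((Coalgebra.counit (R := k)).rTensor E t)) := by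
    induction t with
    | zero => simp
    | tmul x y => exact (map_smul p _ _).symm
    | add x y hx hy => simp only [map_add, hx, hy]
  rw [key, Coalgebra.rTensor_counit_comul] at h
  simpa using h

/-- Transport of a Hopf algebra structure along a coalgebra isomorphism. -/
noncomputable def hopfAlgebraOnOfEquiv {V : Type u} [AddCommGroup V] [Module k V]
    [Coalgebra k V] (e : V ≃ₗc[k] E) : HopfAlgebraOn k V where
  mul := (LinearMap.mul k E).compl₁₂ e.toLinearEquiv.toLinearMap e.toLinearEquiv.toLinearMap
    |>.compr₂ e.symm.toLinearEquiv.toLinearMap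
  one := e.symm 1
  mul_assoc x y z := by simp [mul_assoc]
  one_mul x := by simp
  mul_one x := by simp
  counit_one := by simp
  counit_mul x y := by simp
  comul_one := by
    rw [← CoalgHomClass.map_comp_comul_apply]
    simp [Algebra.TensorProduct.one_def]
  comul_mul x y n m x₁ x₂ y₁ y₂ hx hy := by
    have hx' := CoalgHomClass.map_comp_comul_apply e x
    have hy' := CoalgHomClass.map_comp_comul_apply e y
    rw [hx] at hx'
    rw [hy] at hy'
    simp only [LinearMap.compr₂_apply, LinearMap.compl₁₂_apply, LinearMap.mul_apply']
    refine (CoalgHomClass.map_comp_comul_apply e.symm (e x * e y)).symm.trans ?_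
    rw [Bialgebra.comul_mul, ← hx', ← hy']
    simp [Finset.sum_mul_sum]
  antipode := e.symm.toLinearEquiv.toLinearMap ∘ₗ antipode k ∘ₗ e.toLinearEquiv.toLinearMap
  antipode_mul_id x n x₁ x₂ hx := by
    have h := CoalgHomClass.map_comp_comul_apply e x
    rw [hx] at h
    have h2 := congrArg e.symm (mul_antipode_rTensor_comul_apply (R := k) (e x))
    rw [← h] at h2
    simpa [Algebra.algebraMap_eq_smul_one] using h2
  id_mul_antipode x n x₁ x₂ hx := by
    have h := CoalgHomClass.map_comp_comul_apply e x
    rw [hx] at h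
    have h2 := congrArg e.symm (mul_antipode_lTensor_comul_apply (R := k) (e x))
    rw [← h] at h2
    simpa [Algebra.algebraMap_eq_smul_one] using h2

theorem hopfAlgebraOnOfEquiv_mul {V : Type u} [AddCommGroup V] [Module k V]
    [Coalgebra k V] (e : V ≃ₗc[k] E) (x y : V) :
    (hopfAlgebraOnOfEquiv e).mul x y = e.symm (e x * e y) := rfl

theorem CoalgebraSplitExtension.mem_range_iff (X : CoalgebraSplitExtension k A E H) (z : E) :
    z ∈ Set.range X.i ↔ coaction X.π z = z ⊗ₜ[k] 1 := by
  rw [X.range_i]; rfl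

/-- The coalgebra map `a ⊗ h ↦ i(a) s(h)`. -/
noncomputable def mulSectionHom (i : A →ₐc[k] E) (s : H →ₗc[k] E) : A ⊗[k] H →ₗc[k] E :=
  (Bialgebra.mulCoalgHom k E).comp (Coalgebra.TensorProduct.map i.toCoalgHom s)

@[simp]
theorem mulSectionHom_tmul (i : A →ₐc[k] E) (s : H →ₗc[k] E) (a : A) (h : H) :
    mulSectionHom i s (a ⊗ₜ[k] h) = i a * s h := rfl

theorem CoalgebraSplitExtension.exists_coalgEquiv (X : CoalgebraSplitExtension k A E H)
    (s : H →ₗc[k] E) (hs : ∀ h, X.π (s h) = h) :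
    ∃ (e : A ⊗[k] H ≃ₗc[k] E) (r : E →ₗ[k] A),
      (∀ a h, e (a ⊗ₜ[k] h) = X.i a * s h) ∧ ∀ x, X.i (r x) = retraction X.π s x := by
  have hi (a : A) : coaction X.π (X.i a) = X.i a ⊗ₜ[k] 1 := (X.mem_range_iff _).1 ⟨a, rfl⟩
  let j := LinearEquiv.ofInjective X.i.toLinearMap X.i_injective
  let r : E →ₗ[k] A := j.symm.toLinearMap ∘ₗ (retraction X.π s).codRestrict _
    fun x => (X.mem_range_iff _).2 (coaction_retraction X.π s hs x)
  have hr (x : E) : X.i (r x) = retraction X.π s x :=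
    congrArg Subtype.val (j.apply_symm_apply _)
  let ψ : E →ₗ[k] A ⊗[k] H := TensorProduct.map r LinearMap.id ∘ₗ (coaction X.π).toLinearMap
  have hψφ : ψ ∘ₗ (mulSectionHom X.i s).toLinearMap = LinearMap.id := by
    ext a h
    refine map_coaction_mul_section X.π s hs (hi a) r a (fun h => X.i_injective ?_) h
    rw [hr, retraction_mul_section X.π s hs (hi a), map_smul]
  have hφψ : (mulSectionHom X.i s).toLinearMap ∘ₗ ψ = LinearMap.id := by
    ext x
    have key (t : E ⊗[k] H) : mulSectionHom X.i s (TensorProduct.map r LinearMap.id t) =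
        LinearMap.mul' k E (TensorProduct.map (retraction X.π s) s.toLinearMap t) := by
      induction t with
      | zero => simp
      | tmul x y => simp [hr]
      | add x y hx hy => simp only [map_add, hx, hy]
    exact (key _).trans (mul_map_retraction_coaction X.π s x)
  refine ⟨{ mulSectionHom X.i s with
    invFun := ψ
    left_inv := LinearMap.congr_fun hψφ
    right_inv := LinearMap.congr_fun hφψ }, r, fun _ _ => rfl, hr⟩

end

theorem coalgebra_split_extension_is_crossed_product
    (k : Type u) [Field k]
    (A : Type u) [Ring A] [HopfAlgebra k A] (E : Type u) [Ring E] [HopfAlgebra k E]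
    (H : Type u) [Ring H] [HopfAlgebra k H]
    (ext : CoalgebraSplitExtension k A E H) :
    ∃ (act : H ⊗[k] A →ₗ[k] A) (f : H ⊗[k] H →ₗ[k] A)
      (hs : HopfAlgebraOn k (A ⊗[k] H)),
      hs.one = (1 : A) ⊗ₜ[k] (1 : H) ∧
      CrossedProductMul k A H hs act f ∧
      ∃ ψ : E ≃ₗ[k] A ⊗[k] H,
        (∀ x y : E, ψ (x * y) = hs.mul (ψ x) (ψ y)) ∧
        ψ 1 = hs.one ∧
        IsCoalgebraMap k ψ.toLinearMap ∧
        -- ψ stabilizes A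
        (∀ a : A, ψ (ext.i a) = a ⊗ₜ[k] (1 : H)) ∧
        -- ψ co-stabilizes H : π_H ∘ ψ = π
        (∀ z : E,
          ((TensorProduct.lid k H).toLinearMap ∘ₗ
            TensorProduct.map (Coalgebra.counit (R := k)) LinearMap.id) (ψ z) =
          ext.π z) := by
  obtain ⟨s, hs, hs1⟩ := exists_normalized_section ext.π ext.sec ext.π_sec
  obtain ⟨e, r, he, hr⟩ := ext.exists_coalgEquiv s hs
  have hi (a : A) : coaction ext.π (ext.i a) = ext.i a ⊗ₜ[k] 1 := (ext.mem_range_iff _).1 ⟨a, rfl⟩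
  have he1 (a : A) : e (a ⊗ₜ[k] 1) = ext.i a := by rw [he, hs1, mul_one]
  have hsymm (a : A) : e.symm (ext.i a) = a ⊗ₜ[k] 1 := by rw [← he1, e.symm_apply_apply]
  refine ⟨r ∘ₗ LinearMap.mul' k E ∘ₗ TensorProduct.map s.toLinearMap ext.i.toLinearMap,
    r ∘ₗ LinearMap.mul' k E ∘ₗ TensorProduct.map s.toLinearMap s.toLinearMap,
    hopfAlgebraOnOfEquiv e, ?_, ?_, e.symm.toLinearEquiv, ?_, rfl, ?_, hsymm, ?_⟩
  · rw [← hsymm, map_one]; rfl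
  · intro a c h g n m h₁ h₂ h₃ g₁ g₂ hh hg
    rw [hopfAlgebraOnOfEquiv_mul]
    apply EquivLike.injective e
    rw [e.apply_symm_apply, he, he]
    have key := section_mul_mul_section ext.π s hs (hi c) h g h₁ h₂ h₃ g₁ g₂ hh hg
    simp only [map_sum, he, map_mul, LinearMap.comp_apply, TensorProduct.map_tmul,
      LinearMap.mul'_apply, hr]
    refine Eq.trans (b := ext.i a * (s h * ext.i c * s g)) (by simp only [mul_assoc]) ?_
    rw [← key]
    simp only [Finset.mul_sum, mul_assoc]
    rfl
  · intro x y
    rw [hopfAlgebraOnOfEquiv_mul]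
    change e.symm (x * y) = e.symm (e (e.symm x) * e (e.symm y))
    rw [e.apply_symm_apply, e.apply_symm_apply]
  · exact ⟨e.symm.map_comp_comul.symm, e.symm.counit_comp⟩
  · intro z
    obtain ⟨t, rfl⟩ := EquivLike.surjective e z
    change (_ ∘ₗ _) (e.symm (e t)) = _
    rw [e.symm_apply_apply]
    induction t with
    | zero => simp
    | tmul a h =>
      rw [he, map_mul, hs, map_eq_counit_smul_of_coaction ext.π (hi a),
        CoalgHomClass.counit_comp_apply]
      simp
    | add x y hx hy => simp only [map_add, hx, hy]
end
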